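/- Let H ⊂ ℂ^N be a Levi-flat local real-hypervariety and let M ⊂ closure(H*) ∩ U be a real-analytic generic submanifold. Then M is not a minimal CR submanifold. -/

import Mathlib

/- Common definitions: real-analytic and complex-analytic subvarieties of ℂ^N,
Levi-flat hypervarieties, CR submanifolds, Segre varieties, etc. -/

open Complex Set Topology Filter
open scoped ENNReal

noncomputable section

abbrev CN (N : ℕ) := Fin N → ℂ

/-- `X` is a (relatively closed) real-analytic subvariety of the open set `U ⊆ ℂ^N`. -/
def IsRealSubvariety (N : ℕ) (U X : Set (CN N)) : Prop :=
  X ⊆ U ∧ closure X ∩ U ⊆ X ∧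
    ∀ p ∈ U, ∃ V : Set (CN N), IsOpen V ∧ p ∈ V ∧ V ⊆ U ∧
      ∃ (k : ℕ) (f : Fin k → CN N → ℝ),
        (∀ i, AnalyticOn ℝ (f i) V) ∧ X ∩ V = {z ∈ V | ∀ i, f i z = 0}

/-- `X` is a (relatively closed) complex-analytic subvariety of the open set `U ⊆ ℂ^N`. -/
def IsComplexSubvariety (N : ℕ) (U X : Set (CN N)) : Prop :=
  X ⊆ U ∧ closure X ∩ U ⊆ X ∧
    ∀ p ∈ U, ∃ V : Set (CN N), IsOpen V ∧ p ∈ V ∧ V ⊆ U ∧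
      ∃ (k : ℕ) (f : Fin k → CN N → ℂ),
        (∀ i, AnalyticOn ℂ (f i) V) ∧ X ∩ V = {z ∈ V | ∀ i, f i z = 0}

/-- `X` is a real-analytic subvariety of the (not necessarily open) set `V`. -/
def IsRealSubvarietyIn (N : ℕ) (V X : Set (CN N)) : Prop :=
  X ⊆ V ∧ closure X ∩ V ⊆ X ∧
    ∀ p ∈ V, ∃ W : Set (CN N), IsOpen W ∧ p ∈ W ∧
      ∃ (k : ℕ) (f : Fin k → CN N → ℝ),
        (∀ i, AnalyticOn ℝ (f i) W) ∧ X ∩ W = {z ∈ V ∩ W | ∀ i, f i z = 0}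

/-- `X` is a complex-analytic subvariety of the (not necessarily open) set `V`. -/
def IsComplexSubvarietyIn (N : ℕ) (V X : Set (CN N)) : Prop :=
  X ⊆ V ∧ closure X ∩ V ⊆ X ∧
    ∀ p ∈ V, ∃ W : Set (CN N), IsOpen W ∧ p ∈ W ∧
      ∃ (k : ℕ) (f : Fin k → CN N → ℂ),
        (∀ i, AnalyticOn ℂ (f i) W) ∧ X ∩ W = {z ∈ V ∩ W | ∀ i, f i z = 0}

/-- Near `p`, `X` is a real-analytic submanifold of ℂ^N of real dimension `d`,
cut out by `2N - d` real-analytic functions with linearly independent differentials. -/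
def IsSubmanifoldAtDim (N d : ℕ) (X : Set (CN N)) (p : CN N) : Prop :=
  ∃ (V : Set (CN N)) (f : Fin (2 * N - d) → CN N → ℝ),
    IsOpen V ∧ p ∈ V ∧ (∀ i, AnalyticOn ℝ (f i) V) ∧
    (∀ z ∈ V, LinearIndependent ℝ fun i => fderiv ℝ (f i) z) ∧
    X ∩ V = {z ∈ V | ∀ i, f i z = 0}

/-- Near `p`, `X` is a complex submanifold of ℂ^N of complex dimension `d`. -/
def IsCxSubmanifoldAtDim (N d : ℕ) (X : Set (CN N)) (p : CN N) : Prop :=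
  ∃ (V : Set (CN N)) (f : Fin (N - d) → CN N → ℂ),
    IsOpen V ∧ p ∈ V ∧ (∀ i, AnalyticOn ℂ (f i) V) ∧
    (∀ z ∈ V, LinearIndependent ℂ fun i => fderiv ℂ (f i) z) ∧
    X ∩ V = {z ∈ V | ∀ i, f i z = 0}

/-- Points near which `X` is a real-analytic submanifold of some dimension. -/
def regPts (N : ℕ) (X : Set (CN N)) : Set (CN N) :=
  {p ∈ X | ∃ d, IsSubmanifoldAtDim N d X p}

/-- The singular set `X_s` of a real-analytic subvariety. -/
def singSet (N : ℕ) (X : Set (CN N)) : Set (CN N) := X \ regPts N X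

/-- `H*`: the points near which `H` is a nonsingular real-analytic hypersurface. -/
def hypStar (N : ℕ) (H : Set (CN N)) : Set (CN N) :=
  {p ∈ H | IsSubmanifoldAtDim N (2 * N - 1) H p}

/-- Near `p` the hypersurface `H` is given by `Im f = 0` for a holomorphic `f` with
nonvanishing differential (the local model of a nonsingular Levi-flat hypersurface). -/
def IsLeviFlatHypAt (N : ℕ) (H : Set (CN N)) (p : CN N) : Prop :=
  ∃ (V : Set (CN N)) (f : CN N → ℂ),
    IsOpen V ∧ p ∈ V ∧ AnalyticOn ℂ f V ∧ (∀ z ∈ V, fderiv ℂ f z ≠ 0) ∧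
    H ∩ V = {z ∈ V | (f z).im = 0}

/-- A Levi-flat real-hypervariety `H` of the open set `U`: a relatively closed
real-analytic subvariety of real dimension `2N - 1` whose regular hypersurface
part `H*` is Levi-flat. -/
def IsLeviFlatHypervariety (N : ℕ) (U H : Set (CN N)) : Prop :=
  IsOpen U ∧ IsRealSubvariety N U H ∧ dimH H = ((2 * N - 1 : ℕ) : ℝ≥0∞) ∧
    ∀ p ∈ hypStar N H, IsLeviFlatHypAt N H p

/-- Near `p`, in suitable local holomorphic coordinates `Φ`, the set `M` is given by
`Im z₁ = ⋯ = Im z_j = 0`, `z_{j+1} = ⋯ = z_k = 0`: `M` is a Levi-flat CR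
submanifold at `p`. -/
def IsLeviFlatCRAt (N : ℕ) (M : Set (CN N)) (p : CN N) : Prop :=
  ∃ (V : Set (CN N)) (Φ : CN N → CN N) (j k : ℕ),
    j ≤ k ∧ k ≤ N ∧ IsOpen V ∧ p ∈ V ∧
    AnalyticOn ℂ Φ V ∧ InjOn Φ V ∧
    (∀ z ∈ V, Function.Bijective ⇑(fderiv ℂ Φ z)) ∧
    M ∩ V = {z ∈ V | (∀ i : Fin N, (i : ℕ) < j → (Φ z i).im = 0) ∧
      ∀ i : Fin N, j ≤ (i : ℕ) → (i : ℕ) < k → Φ z i = 0}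

/-- The holomorphic part `∂r` of the differential of a real function `r` at `z`,
as a complex-valued form: `∂r(v) = dr(v) - i · dr(i·v)` (up to a factor `2`). -/
def delForm (N : ℕ) (r : CN N → ℝ) (z : CN N) : CN N → ℂ := fun v =>
  Complex.ofReal (fderiv ℝ r z v) -
    Complex.I * Complex.ofReal (fderiv ℝ r z (Complex.I • v))

/-- `M` is a generic submanifold near `p`: locally cut out by real-analytic
`r₁, …, r_k` with `∂r₁, …, ∂r_k` linearly independent. -/
def IsGenericSubmanifoldAt (N : ℕ) (M : Set (CN N)) (p : CN N) : Prop :=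
  ∃ (V : Set (CN N)) (k : ℕ) (r : Fin k → CN N → ℝ),
    IsOpen V ∧ p ∈ V ∧ (∀ i, AnalyticOn ℝ (r i) V) ∧
    (∀ z ∈ V, LinearIndependent ℝ fun i => fderiv ℝ (r i) z) ∧
    (∀ z ∈ V, LinearIndependent ℂ fun i => delForm N (r i) z) ∧
    M ∩ V = {z ∈ V | ∀ i, r i z = 0}

/-- Near `p`, in suitable local holomorphic coordinates, `M` is `{Im z₁ = Im z₂ = 0}`:
the local model of a generic Levi-flat submanifold of real dimension `2N - 2`. -/
def IsGenericLeviFlat2At (N : ℕ) (M : Set (CN N)) (p : CN N) : Prop :=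
  ∃ (V : Set (CN N)) (Φ : CN N → CN N),
    IsOpen V ∧ p ∈ V ∧ AnalyticOn ℂ Φ V ∧ InjOn Φ V ∧
    (∀ z ∈ V, Function.Bijective ⇑(fderiv ℂ Φ z)) ∧
    M ∩ V = {z ∈ V | ∀ i : Fin N, (i : ℕ) < 2 → (Φ z i).im = 0}

/-- The complex-tangent (CR) vectors to `M` at `p`. -/
def crTangent (N : ℕ) (M : Set (CN N)) (p : CN N) : Set (CN N) :=
  {v | v ∈ tangentConeAt ℝ M p ∧ Complex.I • v ∈ tangentConeAt ℝ M p}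

/-- The CR dimension of `M` at `p`. -/
def crDim (N : ℕ) (M : Set (CN N)) (p : CN N) : ℕ :=
  Module.finrank ℂ (Submodule.span ℂ (crTangent N M p))

/-- `M` is a real-analytic CR submanifold: a real-analytic submanifold with
constant CR dimension. -/
def IsCRSubmanifold (N : ℕ) (M : Set (CN N)) : Prop :=
  (∃ d, ∀ p ∈ M, IsSubmanifoldAtDim N d M p) ∧ ∃ m, ∀ p ∈ M, crDim N M p = m

/-- Coordinatewise complex conjugation. -/
def conjPt (N : ℕ) (z : CN N) : CN N := fun i => starRingEnd ℂ (z i)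

/-- `R` is the complexification `r(z, w̄)` of the real-analytic function `r` on `U`:
it is holomorphic on `U × *U` (where `*U` is the conjugate of `U`) and `R(z, z̄) = r(z)`. -/
def IsComplexification (N : ℕ) (U : Set (CN N)) (r : CN N → ℝ)
    (R : CN N → CN N → ℂ) : Prop :=
  AnalyticOn ℂ (fun zw : CN N × CN N => R zw.1 zw.2) (U ×ˢ (conjPt N '' U)) ∧
    ∀ z ∈ U, R z (conjPt N z) = Complex.ofReal (r z)

/-- The Segre variety `Σ_p(U, r) = {z ∈ U : r(z, p̄) = 0}`, for `R` the
complexification of `r`. -/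
def segreSet (N : ℕ) (U : Set (CN N)) (R : CN N → CN N → ℂ) (p : CN N) : Set (CN N) :=
  {z ∈ U | R z (conjPt N p) = 0}

/-- `p` is a Segre-degenerate singularity of `H`: for every local defining function `r` of
`H` at `p`, the function `z ↦ r(z, p̄)` vanishes identically near `p`. -/
def IsSegreDegenerateAt (N : ℕ) (H : Set (CN N)) (p : CN N) : Prop :=
  ∀ (V : Set (CN N)) (r : CN N → ℝ) (R : CN N → CN N → ℂ),
    IsOpen V → p ∈ V → AnalyticOn ℝ r V → IsComplexification N V r R →
    H ∩ V = {z ∈ V | r z = 0} → ∀ᶠ z in nhds p, R z (conjPt N p) = 0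

/-- `Σ'`: the union of all complex subvarieties of `V` of complex dimension `N - 1`
contained in `H`. -/
def sigmaPrime (N : ℕ) (H V : Set (CN N)) : Set (CN N) :=
  ⋃₀ {W | IsComplexSubvariety N V W ∧ W ⊆ H ∧ dimH W = ((2 * N - 2 : ℕ) : ℝ≥0∞)}

/-- `p` is a leaf-degenerate point of `H`: the germ `Σ'_p(H)` is not a complex variety of
dimension `N - 1`, i.e. there is no single complex subvariety `W ∋ p` of dimension `N - 1`
inside `H` containing all complex hypervarieties of `H` near `p`. -/
def IsLeafDegenerateAt (N : ℕ) (H : Set (CN N)) (p : CN N) : Prop :=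
  ¬∃ (V W : Set (CN N)), IsOpen V ∧ p ∈ V ∧ p ∈ W ∧ W ⊆ H ∧
    IsComplexSubvariety N V W ∧ dimH W = ((2 * N - 2 : ℕ) : ℝ≥0∞) ∧
    ∀ V' : Set (CN N), IsOpen V' → V' ⊆ V → sigmaPrime N H V' ⊆ W

/-- An irreducible complex subvariety of `U`. -/
def IsIrreducibleCxSubvariety (N : ℕ) (U W : Set (CN N)) : Prop :=
  IsComplexSubvariety N U W ∧ W.Nonempty ∧
    ∀ W₁ W₂ : Set (CN N), IsComplexSubvariety N U W₁ → IsComplexSubvariety N U W₂ →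
      W = W₁ ∪ W₂ → W = W₁ ∨ W = W₂

/-- The germ of the real-analytic variety `H` at `p` is irreducible: in any decomposition
of `H` near `p` into two real-analytic subvarieties, one of them contains `H` near `p`. -/
def IsIrreducibleGermAt (N : ℕ) (H : Set (CN N)) (p : CN N) : Prop :=
  ∀ V H₁ H₂ : Set (CN N), IsOpen V → p ∈ V →
    IsRealSubvariety N V H₁ → IsRealSubvariety N V H₂ → H ∩ V = H₁ ∪ H₂ →
    ∃ V' : Set (CN N), IsOpen V' ∧ p ∈ V' ∧ (H ∩ V' ⊆ H₁ ∨ H ∩ V' ⊆ H₂)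

/-- `M` is minimal at `p`: every (real-analytic) CR submanifold of `M` through `p` with
the same CR dimension contains a neighborhood of `p` in `M`. -/
def IsMinimalAt (N : ℕ) (M : Set (CN N)) (p : CN N) : Prop :=
  ∀ M' : Set (CN N), p ∈ M' → M' ⊆ M →
    (∃ d, ∀ q ∈ M', IsSubmanifoldAtDim N d M' q) →
    (∀ q ∈ M', crDim N M' q = crDim N M p) →
    ∃ V : Set (CN N), IsOpen V ∧ p ∈ V ∧ M ∩ V ⊆ M'

/-- `O` is (a representative of) the local CR orbit of `M` at `p`, of dimension `d`:
the smallest CR submanifold of `M` through `p` of the same CR dimension as `M` at `p`. -/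
def IsCROrbitAt (N d : ℕ) (M O : Set (CN N)) (p : CN N) : Prop :=
  p ∈ O ∧ O ⊆ M ∧ (∀ q ∈ O, IsSubmanifoldAtDim N d O q) ∧
    (∀ q ∈ O, crDim N O q = crDim N M p) ∧
    ∀ O' : Set (CN N), p ∈ O' → O' ⊆ M →
      (∃ d', ∀ q ∈ O', IsSubmanifoldAtDim N d' O' q) →
      (∀ q ∈ O', crDim N O' q = crDim N M p) →
      ∃ V : Set (CN N), IsOpen V ∧ p ∈ V ∧ O ∩ V ⊆ O'

/-- `r` generates the ideal of germs at `p` of real-analytic functions vanishing on `H`. -/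
def GeneratesVanishingIdealAt (N : ℕ) (H V : Set (CN N)) (r : CN N → ℝ) (p : CN N) :
    Prop :=
  (∀ z ∈ H ∩ V, r z = 0) ∧
    ∀ (V' : Set (CN N)) (g : CN N → ℝ), IsOpen V' → p ∈ V' → AnalyticOn ℝ g V' →
      (∀ z ∈ H ∩ V', g z = 0) →
      ∃ (V'' : Set (CN N)) (q : CN N → ℝ), IsOpen V'' ∧ p ∈ V'' ∧ V'' ⊆ V ∩ V' ∧
        AnalyticOn ℝ q V'' ∧ ∀ z ∈ V'', g z = q z * r z

/-- The exterior derivative of a one-form `ω`, evaluated at `z` on `(u, v)`. -/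
def oneFormD (N : ℕ) (ω : CN N → (CN N →L[ℂ] ℂ)) (z u v : CN N) : ℂ :=
  fderiv ℂ ω z u v - fderiv ℂ ω z v u

/-- `(ω ∧ dω)(u, v, w)` at `z`; its vanishing is complete integrability of `ω`. -/
def integrabilityWedge (N : ℕ) (ω : CN N → (CN N →L[ℂ] ℂ)) (z u v w : CN N) : ℂ :=
  ω z u * oneFormD N ω z v w - ω z v * oneFormD N ω z u w + ω z w * oneFormD N ω z u v

/-- A linearly independent family of functionals is jointly surjective. -/
theorem LinearIndependent.surjective_pi_dual {K E ι : Type*} [Field K] [AddCommGroup E] [Module K E]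
    [Fintype ι] {φ : ι → E →ₗ[K] K} (h : LinearIndependent K φ) :
    Function.Surjective (LinearMap.pi φ) := by
  classical
  rw [← LinearMap.range_eq_top]
  by_contra hne
  obtain ⟨g, hg0, hg⟩ := Submodule.exists_le_ker_of_lt_top _ (lt_top_iff_ne_top.2 hne)
  apply hg0
  have key : ∑ i, g (Pi.single i 1) • φ i = 0 := by
    ext v
    have := hg (LinearMap.mem_range_self (LinearMap.pi φ) v)
    rw [LinearMap.mem_ker, LinearMap.pi_apply_eq_sum_univ] at this
    have hs : ∀ i : ι, (fun j => if i = j then (1 : K) else 0) = Pi.single i 1 := fun i => by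
      ext j; simp [Pi.single_apply, eq_comm]
    simpa [hs, mul_comm] using this
  have := Fintype.linearIndependent_iff.1 h _ key
  ext i
  simpa using this i

theorem tangentConeAt_eq_ker {E ι : Type*} [NormedAddCommGroup E] [NormedSpace ℝ E]
    [CompleteSpace E] [Fintype ι] {X V : Set E} {r : ι → E → ℝ} {q : E} (hV : IsOpen V)
    (hX : X ∩ V = {z ∈ V | ∀ i, r i z = 0}) (hq : q ∈ X ∩ V) (hr : ∀ i, AnalyticAt ℝ (r i) q)
    (hind : LinearIndependent ℝ fun i => fderiv ℝ (r i) q) :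
    tangentConeAt ℝ X q = {v | ∀ i, fderiv ℝ (r i) q v = 0} := by
  rw [← tangentConeAt_inter_nhds (hV.mem_nhds hq.2)]
  ext v
  constructor
  · intro hv i
    have h1 : HasFDerivWithinAt (r i) (fderiv ℝ (r i) q) (X ∩ V) q :=
      (hr i).differentiableAt.hasFDerivAt.hasFDerivWithinAt
    have h0 : ∀ z ∈ X ∩ V, r i z = 0 := fun z hz => by
      rw [hX] at hz; exact hz.2 i
    have h2 : HasFDerivWithinAt (r i) (0 : E →L[ℝ] ℝ) (X ∩ V) q :=
      (hasFDerivWithinAt_const (0 : ℝ) q (X ∩ V)).congr h0 (h0 q hq)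
    exact h1.unique_on h2 hv
  · intro hv
    set f : E → ι → ℝ := fun z i => r i z with hfdef
    set f' : E →L[ℝ] ι → ℝ := ContinuousLinearMap.pi fun i => fderiv ℝ (r i) q with hf'
    have hf : HasStrictFDerivAt f f' q :=
      hasStrictFDerivAt_pi.2 fun i => (hr i).hasStrictFDerivAt
    have hsurj : f'.range = ⊤ := by
      refine LinearMap.range_eq_top.2 ?_
      have : LinearIndependent ℝ fun i => (fderiv ℝ (r i) q).toLinearMap :=
        hind.map' (ContinuousLinearMap.coeLM ℝ) (LinearMap.ker_eq_bot.2
          ContinuousLinearMap.coe_injective)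
      exact this.surjective_pi_dual
    have hfq : f q = 0 := by
      rw [hX] at hq; exact funext hq.2
    set φ := hf.implicitFunction f f' hsurj (f q) with hφ
    have hφ' : HasStrictFDerivAt φ (f'.ker).subtypeL 0 := hf.to_implicitFunction hsurj
    have hφ0 : φ 0 = q := by
      exact hf.implicitFunction_apply_image hsurj
    have hev : ∀ᶠ y in 𝓝 (0 : f'.ker), f (φ y) = f q := by
      have := hf.map_implicitFunction_eq hsurj
      exact (Continuous.prodMk_right (f q)).continuousAt.eventually this
    have hev2 : ∀ᶠ y in 𝓝 (0 : f'.ker), φ y ∈ V :=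
      hφ'.continuousAt.eventually (by rw [hφ0]; exact hV.mem_nhds hq.2)
    set S : Set f'.ker := {y | f (φ y) = f q ∧ φ y ∈ V}
    have hS : S ∈ 𝓝 (0 : f'.ker) := hev.and hev2
    have hmem : v ∈ f'.ker := by
      exact funext hv
    have h3 : v ∈ tangentConeAt ℝ (φ '' S) (φ 0) :=
      (hφ'.hasFDerivAt.hasFDerivWithinAt (s := S)).mapsTo_tangent_cone
        (by rw [tangentConeAt_of_mem_nhds hS]; trivial : (⟨v, hmem⟩ : f'.ker) ∈ _)
    rw [hφ0] at h3
    refine tangentConeAt_mono ?_ h3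
    rintro _ ⟨y, hy, rfl⟩
    rw [hX]
    exact ⟨hy.2, fun i => congrFun (hy.1.trans hfq) i⟩

theorem AnalyticOnNhd.eventuallyEq_zero_of_span_tangentConeAt {E F : Type*} [NormedAddCommGroup E]
    [NormedSpace ℂ E] [NormedAddCommGroup F] [NormedSpace ℂ F] [CompleteSpace F] {A V : Set E} {f : E → F}
    (hf : AnalyticOnNhd ℂ f V) (hV : IsOpen V)
    (hA : ∀ a ∈ A ∩ V, Submodule.span ℂ (tangentConeAt ℝ A a) = ⊤) (h0 : ∀ a ∈ A ∩ V, f a = 0)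
    {a : E} (ha : a ∈ A ∩ V) : f =ᶠ[𝓝 a] 0 := by
  have key : ∀ n, ∀ a ∈ A ∩ V, iteratedFDeriv ℂ n f a = 0 := by
    intro n
    induction n with
    | zero => intro a ha; ext; simp [h0 a ha]
    | succ n ih =>
      intro a ha
      have hg : AnalyticAt ℂ (iteratedFDeriv ℂ n f) a := hf.iteratedFDeriv n a ha.2
      have hd := hg.differentiableAt.hasFDerivAt
      have hdR : HasFDerivWithinAt (iteratedFDeriv ℂ n f)
        ((fderiv ℂ (iteratedFDeriv ℂ n f) a).restrictScalars ℝ) (A ∩ V) a :=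
        (hd.restrictScalars ℝ).hasFDerivWithinAt
      have hd0 : HasFDerivWithinAt (iteratedFDeriv ℂ n f) (0 : E →L[ℝ] _) (A ∩ V) a :=
        (hasFDerivWithinAt_const (0 : E [×n]→L[ℂ] F) a (A ∩ V)).congr ih (ih a ha)
      have heq := hdR.unique_on hd0
      have hz : fderiv ℂ (iteratedFDeriv ℂ n f) a = 0 := by
        have : Submodule.span ℂ (tangentConeAt ℝ A a) ≤
            LinearMap.ker (fderiv ℂ (iteratedFDeriv ℂ n f) a).toLinearMap := by
          refine Submodule.span_le.2 fun v hv => ?_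
          rw [← tangentConeAt_inter_nhds (hV.mem_nhds ha.2)] at hv
          exact heq hv
        rw [hA a ha, top_le_iff, LinearMap.ker_eq_top] at this
        ext1 v
        exact congrArg (fun l => l v) this
      ext v
      rw [iteratedFDeriv_succ_apply_left, hz]; rfl
  obtain ⟨p, ρ, hp⟩ := hf a ha.2
  have hball : Metric.eball a ρ ∈ 𝓝 a := Metric.eball_mem_nhds a hp.r_pos
  filter_upwards [hball] with z hz
  have := hp.hasSum_iteratedFDeriv (y := z - a) (by simpa [edist_eq_enorm_sub] using hz)
  simp only [key _ a ha] at this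
  simpa using this.unique (by simp)

/-- `delForm` as a complex linear functional. -/
def delFormLin (N : ℕ) (r : CN N → ℝ) (z : CN N) : CN N →ₗ[ℂ] ℂ where
  toFun := delForm N r z
  map_add' u v := by simp [delForm]; ring
  map_smul' c v := by
    have h : ∀ (c : ℂ) (v : CN N), fderiv ℝ r z (c • v) =
        c.re * fderiv ℝ r z v + c.im * fderiv ℝ r z (I • v) := fun c v => by
      have : c • v = c.re • v + c.im • (I • v) := by
        ext i; simp only [Pi.add_apply, Pi.smul_apply, smul_eq_mul, real_smul]
        nth_rw 1 [← re_add_im c]; ring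
      rw [this]; simp
    have h2 : I • c • v = (I * c) • v := by rw [smul_smul]
    simp only [delForm, h2, h c v, h (I * c) v]
    apply Complex.ext <;> simp

theorem delFormLin_eq_zero_iff (N : ℕ) (r : CN N → ℝ) (z v : CN N) :
    delFormLin N r z v = 0 ↔ fderiv ℝ r z v = 0 ∧ fderiv ℝ r z (I • v) = 0 := by
  change delForm N r z v = 0 ↔ _
  rw [Complex.ext_iff]
  simp [delForm]

theorem linearIndependent_delFormLin {N : ℕ} {ι : Type*} {r : ι → CN N → ℝ} {z : CN N}
    (h : LinearIndependent ℂ fun i => delForm N (r i) z) :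
    LinearIndependent ℂ fun i => delFormLin N (r i) z :=
  LinearIndependent.of_comp (LinearMap.ltoFun ℂ (CN N) ℂ ℂ) h

theorem span_ker_eq_top {N : ℕ} {ι : Type*} [Fintype ι] {r : ι → CN N → ℝ} {z : CN N}
    (h : LinearIndependent ℂ fun i => delForm N (r i) z) :
    Submodule.span ℂ {v | ∀ i, fderiv ℝ (r i) z v = 0} = ⊤ := by
  by_contra hne
  obtain ⟨g, hg0, hg⟩ := Submodule.exists_le_ker_of_lt_top _ (lt_top_iff_ne_top.2 hne)
  apply hg0
  have hgT : ∀ v, (∀ i, fderiv ℝ (r i) z v = 0) → g v = 0 := fun v hv =>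
    hg (Submodule.subset_span hv)
  have key : ∀ l : CN N →ₗ[ℝ] ℝ, (∀ v, g v = 0 → l v = 0) →
      ∃ a : ι → ℝ, ∀ v, l v = ∑ i, a i * fderiv ℝ (r i) z v := fun l hl => by
    have : l ∈ Submodule.span ℝ (range fun i => (fderiv ℝ (r i) z).toLinearMap) := by
      refine mem_span_of_iInf_ker_le_ker fun v hv => ?_
      simp only [Submodule.mem_iInf, LinearMap.mem_ker] at hv ⊢
      exact hl v (hgT v hv)
    obtain ⟨a, ha⟩ := (Submodule.mem_span_range_iff_exists_fun ℝ).1 this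
    exact ⟨a, fun v => by rw [← ha]; simp⟩
  obtain ⟨a, ha⟩ := key (reLm ∘ₗ g.restrictScalars ℝ) fun v hv => by simp [hv]
  obtain ⟨b, hb⟩ := key (imLm ∘ₗ g.restrictScalars ℝ) fun v hv => by simp [hv]
  simp only [LinearMap.comp_apply, LinearMap.restrictScalars_apply, reLm_coe, imLm_coe] at ha hb
  have hI : ∀ v, g (I • v) = I * g v := fun v => by simp
  have h1 : ∀ v, g v = ∑ i, (a i : ℂ) * delForm N (r i) z v := fun v => by
    have h2 := ha (I • v)
    rw [hI] at h2
    have : g v = ((g v).re : ℂ) - I * ((I * g v).re : ℂ) := by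
      apply Complex.ext <;> simp
    rw [this, ha, h2]
    simp only [delForm, mul_sub, Finset.sum_sub_distrib, ofReal_sum, ofReal_mul, Finset.mul_sum]
    congr 1
    exact Finset.sum_congr rfl fun i _ => by ring
  have h2 : ∀ v, g v = ∑ i, (I * b i : ℂ) * delForm N (r i) z v := fun v => by
    have h2 := hb (I • v)
    rw [hI] at h2
    have : g v = I * (((g v).im : ℂ) - I * ((I * g v).im : ℂ)) := by
      apply Complex.ext <;> simp
    rw [this, hb, h2]
    simp only [delForm, mul_sub, Finset.sum_sub_distrib, ofReal_sum, ofReal_mul, Finset.mul_sum]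
    congr 1 <;> exact Finset.sum_congr rfl fun i _ => by ring
  have h3 : ∑ i, ((a i : ℂ) - I * b i) • delForm N (r i) z = 0 := by
    ext v
    have := (h1 v).symm.trans (h2 v)
    simp only [Finset.sum_apply, Pi.smul_apply, smul_eq_mul, sub_mul, Finset.sum_sub_distrib,
      this, sub_self, Pi.zero_apply]
  have h4 := Fintype.linearIndependent_iff.1 h _ h3
  have h5 : ∀ i, a i = 0 := fun i => by
    have := congrArg Complex.re (h4 i)
    simpa using this
  ext v
  simp [h1, h5]

section Generic

variable {N k : ℕ} {M V : Set (CN N)} {r : Fin k → CN N → ℝ} {q : CN N}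

theorem crTangent_eq (hT : tangentConeAt ℝ M q = {v | ∀ i, fderiv ℝ (r i) q v = 0}) :
    crTangent N M q = LinearMap.ker (LinearMap.pi fun i => delFormLin N (r i) q) := by
  ext v
  simp only [crTangent, hT, mem_ofPred_eq, SetLike.mem_coe, LinearMap.mem_ker, funext_iff,
    LinearMap.pi_apply, delFormLin_eq_zero_iff, Pi.zero_apply, forall_and]

theorem crDim_eq (hT : tangentConeAt ℝ M q = {v | ∀ i, fderiv ℝ (r i) q v = 0})
    (h : LinearIndependent ℂ fun i => delForm N (r i) q) : crDim N M q = N - k := by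
  rw [crDim, crTangent_eq hT, Submodule.span_eq]
  have h1 := LinearMap.finrank_range_add_finrank_ker (LinearMap.pi fun i => delFormLin N (r i) q)
  rw [LinearMap.range_eq_top.2 (linearIndependent_delFormLin h).surjective_pi_dual] at h1
  simp at h1
  omega

end Generic

section Complexify

variable {E W J : Type*} [NormedAddCommGroup E] [NormedSpace ℝ E] [NormedAddCommGroup W]
  [NormedSpace ℂ W] [Fintype J]

/-- The complex power series obtained from a real one by substituting complex linear forms
`X j` for the real coordinates with respect to the frame `e`. -/
def FormalMultilinearSeries.complexify (p : FormalMultilinearSeries ℝ E ℝ) (e : J → E)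
    (X : J → W →L[ℂ] ℂ) : FormalMultilinearSeries ℂ W ℂ := fun n =>
  ∑ j : Fin n → J, (p n (fun s => e (j s)) : ℂ) •
    (ContinuousMultilinearMap.mkPiAlgebra ℂ (Fin n) ℂ).compContinuousLinearMap fun s => X (j s)

theorem FormalMultilinearSeries.complexify_apply (p : FormalMultilinearSeries ℝ E ℝ) (e : J → E)
    (X : J → W →L[ℂ] ℂ) (n : ℕ) (u : W) : p.complexify e X n (fun _ => u) =
      ∑ j : Fin n → J, (p n (fun s => e (j s)) : ℂ) * ∏ s, X (j s) u := by
  simp [FormalMultilinearSeries.complexify]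

theorem FormalMultilinearSeries.complexify_apply_real (p : FormalMultilinearSeries ℝ E ℝ)
    (e : J → E) (X : J → W →L[ℂ] ℂ) (n : ℕ) {u : W} {y : E} {x : J → ℝ}
    (hx : ∀ j, X j u = x j) (hy : ∑ j, x j • e j = y) :
    p.complexify e X n (fun _ => u) = (p n (fun _ => y) : ℝ) := by
  classical
  rw [complexify_apply, ← hy]
  have := (p n).toMultilinearMap.map_sum (fun (_ : Fin n) j => x j • e j)
  simp only [ContinuousMultilinearMap.coe_coe] at this
  rw [this]
  push_cast
  refine Finset.sum_congr rfl fun j _ => ?_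
  have := (p n).map_smul_univ (fun s => x (j s)) (fun s => e (j s))
  rw [this]
  simp [hx, mul_comm]

theorem FormalMultilinearSeries.norm_complexify_le (p : FormalMultilinearSeries ℝ E ℝ) (e : J → E)
    (X : J → W →L[ℂ] ℂ) (n : ℕ) :
    ‖p.complexify e X n‖ ≤ ‖p n‖ * (∑ j, ‖e j‖ * ‖X j‖) ^ n := by
  classical
  have h1 : (∑ j, ‖e j‖ * ‖X j‖) ^ n = ∑ j : Fin n → J, ∏ s, ‖e (j s)‖ * ‖X (j s)‖ := by
    have := Finset.prod_univ_sum (fun _ : Fin n => (Finset.univ : Finset J))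
      (fun _ j => ‖e j‖ * ‖X j‖)
    simpa using this
  rw [h1, Finset.mul_sum]
  refine norm_sum_le_of_le _ fun j _ => ?_
  rw [norm_smul, Complex.norm_real, Finset.prod_mul_distrib, ← mul_assoc]
  refine mul_le_mul ((p n).le_opNorm _) ?_ (norm_nonneg _) (by positivity)
  refine (ContinuousMultilinearMap.norm_compContinuousLinearMap_le _ _).trans ?_
  simp

theorem FormalMultilinearSeries.complexify_radius_pos {p : FormalMultilinearSeries ℝ E ℝ}
    (hp : 0 < p.radius) (e : J → E) (X : J → W →L[ℂ] ℂ) : 0 < (p.complexify e X).radius := by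
  obtain ⟨r, hr0, hr⟩ := ENNReal.lt_iff_exists_nnreal_btwn.1 hp
  obtain ⟨C, hC, hb⟩ := p.norm_mul_pow_le_of_lt_radius hr
  set K : NNReal := ∑ j, ‖e j‖₊ * ‖X j‖₊ + 1 with hK
  have hK1 : ∑ j, ‖e j‖ * ‖X j‖ ≤ (K : ℝ) := by rw [hK]; push_cast; linarith
  have hKpos : (0 : ℝ) < K := by rw [hK]; push_cast; positivity
  have : ((r / K : NNReal) : ℝ≥0∞) ≤ (p.complexify e X).radius := by
    refine FormalMultilinearSeries.le_radius_of_bound _ C fun n => ?_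
    calc ‖p.complexify e X n‖ * ((r / K : NNReal) : ℝ) ^ n
        ≤ ‖p n‖ * (K : ℝ) ^ n * ((r / K : NNReal) : ℝ) ^ n := by
          gcongr
          exact (p.norm_complexify_le e X n).trans (by gcongr)
      _ = ‖p n‖ * r ^ n := by
          push_cast; rw [mul_assoc, ← mul_pow, mul_div_cancel₀ _ hKpos.ne']
      _ ≤ C := hb n
  refine lt_of_lt_of_le ?_ this
  have hr0' : 0 < r := by exact_mod_cast hr0
  have hK0 : 0 < K := by exact_mod_cast hKpos
  exact_mod_cast div_pos hr0' hK0

end Complexify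

theorem AnalyticAt.exists_complexification {N : ℕ} {ρ : CN N → ℝ} {p0 : CN N}
    (h : AnalyticAt ℝ ρ p0) : ∃ ε > 0, ∃ R : CN N × CN N → ℂ,
      AnalyticOnNhd ℂ R (Metric.ball p0 ε ×ˢ Metric.ball (star p0) ε) ∧
      (∀ z ∈ Metric.ball p0 ε, R (z, star z) = ρ z) ∧
      ∀ z w, R (star w, star z) = star (R (z, w)) := by
  classical
  obtain ⟨p, r, hp⟩ := h
  set e : Fin N ⊕ Fin N → CN N :=
    Sum.elim (fun i => Pi.single i 1) (fun i => Pi.single i I) with he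
  set X : Fin N ⊕ Fin N → (CN N × CN N) →L[ℂ] ℂ := Sum.elim
    (fun i => (1 / 2 : ℂ) • (((ContinuousLinearMap.proj i).comp (.fst ℂ _ _)) +
      ((ContinuousLinearMap.proj i).comp (.snd ℂ _ _))))
    (fun i => (1 / (2 * I) : ℂ) • (((ContinuousLinearMap.proj i).comp (.fst ℂ _ _)) -
      ((ContinuousLinearMap.proj i).comp (.snd ℂ _ _)))) with hX
  set P := p.complexify e X with hP
  have hPpos : 0 < P.radius := p.complexify_radius_pos (hp.r_pos.trans_le hp.r_le) e X
  have hPs := P.hasFPowerSeriesOnBall hPpos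
  set c0 : CN N × CN N := (p0, star p0) with hc0
  obtain ⟨ε, hε0, hε⟩ := ENNReal.lt_iff_exists_nnreal_btwn.1 (lt_min hPpos hp.r_pos)
  have hε0' : (0 : ℝ) < ε := by exact_mod_cast hε0
  refine ⟨ε, hε0', fun u => P.sum (u - c0), ?_, ?_, ?_⟩
  · intro u hu
    have h1 : AnalyticAt ℂ P.sum (u - c0) := by
      refine hPs.analyticAt_of_mem ?_
      rw [ball_prod_same, ← hc0, mem_ball_iff_norm] at hu
      simp only [Metric.mem_eball, edist_zero_right]
      refine lt_trans ?_ (hε.trans_le (min_le_left _ _))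
      rw [enorm_eq_nnnorm]; exact_mod_cast hu
    exact h1.comp_of_eq (analyticAt_id.sub analyticAt_const) rfl
  · intro z hz
    have hy : ‖z - p0‖₊ < ε := by rw [mem_ball_iff_norm] at hz; exact_mod_cast hz
    have h1 := hp.hasSum (y := z - p0) (by
      simp only [Metric.mem_eball, edist_zero_right]
      refine lt_trans ?_ (hε.trans_le (min_le_right _ _))
      rw [enorm_eq_nnnorm]; exact_mod_cast hy)
    have h2 : ∀ n, P n (fun _ => (z, star z) - c0) = (p n (fun _ => z - p0) : ℝ) := fun n => by
      refine p.complexify_apply_real e X n (x := Sum.elim (fun i => (z i - p0 i).re)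
        (fun i => (z i - p0 i).im)) ?_ ?_
      · rintro (i | i)
        · simp [hX, hc0]
          apply Complex.ext <;> simp <;> ring
        · simp [hX, hc0]
          apply Complex.ext <;> simp <;> ring
      · ext i
        simp only [he, Fintype.sum_sum_type, Sum.elim_inl, Sum.elim_inr,
          Finset.sum_apply, Pi.smul_apply, Pi.sub_apply, Pi.single_apply]
        simp only [smul_ite, smul_zero, Finset.sum_ite_eq, Finset.mem_univ, if_true]
        exact Complex.ext (by simp) (by simp)
    have h3 : P.sum ((z, star z) - c0) = ∑' n, ((p n (fun _ => z - p0) : ℝ) : ℂ) := by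
      simp only [FormalMultilinearSeries.sum, h2]
    change P.sum ((z, star z) - c0) = ρ z
    rw [h3, ← ofReal_tsum, h1.tsum_eq, add_sub_cancel]
  · intro z w
    have h2 : ∀ n, P n (fun _ => (star w, star z) - c0) = star (P n (fun _ => (z, w) - c0)) := by
      intro n
      rw [hP, FormalMultilinearSeries.complexify_apply, FormalMultilinearSeries.complexify_apply]
      simp only [star_sum, star_mul', star_prod]
      refine Finset.sum_congr rfl fun j _ => ?_
      congr 1
      · simp
      · refine Finset.prod_congr rfl fun s _ => ?_
        rcases j s with i | i
        · simp [hX, hc0]; ring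
        · simp [hX, hc0]; ring
    simp only [FormalMultilinearSeries.sum, h2]
    exact (Complex.conj_tsum _).symm

/-- The conjugate of a continuous multilinear map. -/
def ContinuousMultilinearMap.starConj {ι E F : Type*} [NormedAddCommGroup E] [NormedSpace ℂ E]
    [NormedAddCommGroup F] [NormedSpace ℂ F] [StarAddMonoid E] [StarModule ℂ E] [NormedStarGroup E]
    [StarAddMonoid F] [StarModule ℂ F] [NormedStarGroup F]
    (m : ContinuousMultilinearMap ℂ (fun _ : ι => E) F) :
    ContinuousMultilinearMap ℂ (fun _ : ι => E) F where
  toFun v := star (m fun i => star (v i))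
  map_update_add' v i x y := by
    classical
    have : ∀ x, (fun j => star (Function.update v i x j)) =
        Function.update (fun j => star (v j)) i (star x) := fun x => by
      ext j; by_cases h : j = i
      · subst h; simp
      · simp [h]
    have h1 := m.map_update_add (fun j => star (v j)) i (star x) (star y)
    rw [← star_add] at h1
    convert congrArg star h1 using 2
    · rw [← this]
    · rw [star_add, ← this, ← this]
  map_update_smul' v i c x := by
    classical
    have : ∀ x, (fun j => star (Function.update v i x j)) =
        Function.update (fun j => star (v j)) i (star x) := fun x => by
      ext j; by_cases h : j = i
      · subst h; simp
      · simp [h]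
    have h1 := m.map_update_smul (fun j => star (v j)) i (star c) (star x)
    rw [← star_smul] at h1
    convert congrArg star h1 using 2
    · rw [← this]
    · rw [star_smul, star_star, ← this]
  cont := by
    have := m.cont
    exact continuous_star.comp (this.comp (continuous_pi fun i =>
      continuous_star.comp (continuous_apply i)))

theorem AnalyticAt.star_star {E F : Type*} [NormedAddCommGroup E] [NormedSpace ℂ E]
    [NormedAddCommGroup F] [NormedSpace ℂ F] [StarAddMonoid E] [StarModule ℂ E] [NormedStarGroup E]
    [StarAddMonoid F] [StarModule ℂ F] [NormedStarGroup F] {f : E → F} {x : E}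
    (h : AnalyticAt ℂ f (star x)) : AnalyticAt ℂ (fun z => star (f (star z))) x := by
  obtain ⟨p, r, hp⟩ := h
  refine ⟨fun n => (p n).starConj, r, ?_, hp.r_pos, ?_⟩
  · refine ENNReal.le_of_forall_nnreal_lt fun r' hr' => ?_
    obtain ⟨C, hC, hb⟩ := p.norm_mul_pow_le_of_lt_radius (hr'.trans_le hp.r_le)
    refine FormalMultilinearSeries.le_radius_of_bound _ C fun n => le_trans ?_ (hb n)
    gcongr
    refine ContinuousMultilinearMap.opNorm_le_bound (norm_nonneg _) fun v => ?_
    change ‖star (p n fun i => star (v i))‖ ≤ _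
    rw [norm_star]
    refine ((p n).le_opNorm _).trans ?_
    simp
  · intro y hy
    have := hp.hasSum (y := star y) (by
      simp only [Metric.mem_eball, edist_zero_right] at hy ⊢
      rw [enorm_eq_nnnorm, nnnorm_star]; exact hy)
    have h2 := this.map (starAddEquiv (R := F)) continuous_star
    simp only [star_add]
    exact h2

theorem differentiableOn_circleIntegral {φ : ℂ × ℂ → ℂ} {r : ℝ} {T : Set ℂ} (hr : 0 < r)
    (hT : IsOpen T) (hφ : AnalyticOnNhd ℂ φ (Metric.sphere 0 r ×ˢ T)) :
    DifferentiableOn ℂ (fun t => ∮ x in C(0, r), φ (x, t)) T := by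
  intro t0 ht0
  obtain ⟨s, hs, hsT⟩ := Metric.nhds_basis_closedBall.mem_iff.1 (hT.mem_nhds ht0)
  have hcont' : ContinuousOn (fun z => fderiv ℂ φ z (0, 1)) (Metric.sphere 0 r ×ˢ T) := by
    exact (hφ.fderiv.continuousOn).clm_apply continuousOn_const
  obtain ⟨C, hC⟩ := ((isCompact_sphere (0 : ℂ) r).prod (isCompact_closedBall t0 s)).exists_bound_of_continuousOn
    (hcont'.mono (prod_mono le_rfl hsT))
  have hcm : ∀ θ, circleMap 0 r θ ∈ Metric.sphere (0 : ℂ) r := fun θ =>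
    circleMap_mem_sphere _ hr.le _
  have hFc : ∀ t ∈ T, Continuous fun θ => deriv (circleMap 0 r) θ • φ (circleMap 0 r θ, t) := by
    intro t ht
    simp only [deriv_circleMap]
    refine ((continuous_circleMap 0 r).mul continuous_const).smul ?_
    exact hφ.continuousOn.comp_continuous
      ((continuous_circleMap 0 r).prodMk continuous_const) fun θ => ⟨hcm θ, ht⟩
  have hF'c : Continuous fun θ => deriv (circleMap 0 r) θ •
      fderiv ℂ φ (circleMap 0 r θ, t0) (0, 1) := by
    simp only [deriv_circleMap]
    refine ((continuous_circleMap 0 r).mul continuous_const).smul ?_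
    exact hcont'.comp_continuous
      ((continuous_circleMap 0 r).prodMk continuous_const) fun θ => ⟨hcm θ, ht0⟩
  have key := intervalIntegral.hasDerivAt_integral_of_dominated_loc_of_deriv_le (μ := MeasureTheory.volume)
    (a := 0) (b := 2 * Real.pi) (x₀ := t0) (s := Metric.ball t0 s) (𝕜 := ℂ)
    (F := fun t θ => deriv (circleMap 0 r) θ • φ (circleMap 0 r θ, t))
    (F' := fun t θ => deriv (circleMap 0 r) θ • fderiv ℂ φ (circleMap 0 r θ, t) (0, 1))
    (bound := fun _ => r * C) (Metric.ball_mem_nhds t0 hs)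
    ?_ ((hFc t0 ht0).intervalIntegrable _ _) hF'c.aestronglyMeasurable ?_ (by simp) ?_
  · exact key.2.differentiableAt.differentiableWithinAt
  · filter_upwards [hT.mem_nhds ht0] with t ht using (hFc t ht).aestronglyMeasurable
  · refine Filter.Eventually.of_forall fun θ _ t ht => ?_
    rw [norm_smul]
    refine mul_le_mul ?_ (hC _ ⟨hcm θ, Metric.ball_subset_closedBall ht⟩) (norm_nonneg _) hr.le
    simp [deriv_circleMap, abs_of_pos hr]
  · refine Filter.Eventually.of_forall fun θ _ t ht => ?_
    have h1 := (hφ (circleMap 0 r θ, t) ⟨hcm θ, hsT (Metric.ball_subset_closedBall ht)⟩).differentiableAt.hasFDerivAt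
    have h2 : HasDerivAt (fun t => (circleMap 0 r θ, t)) ((0 : ℂ), (1 : ℂ)) t :=
      (hasDerivAt_const t _).prodMk (hasDerivAt_id t)
    exact (h1.comp_hasDerivAt t h2).const_smul (deriv (circleMap 0 r) θ)

/-- The argument principle with weights, for a function without zeros on the circle. -/
theorem exists_multiset_circleIntegral_logDeriv {r : ℝ} (hr : 0 < r) {g : ℂ → ℂ}
    (hg : AnalyticOnNhd ℂ g (Metric.closedBall 0 r)) (hne : ∀ x ∈ Metric.sphere 0 r, g x ≠ 0) :
    ∃ s : Multiset ℂ, (∀ c, c ∈ s ↔ c ∈ Metric.ball 0 r ∧ g c = 0) ∧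
      ∀ h : ℂ → ℂ, AnalyticOnNhd ℂ h (Metric.closedBall 0 r) →
        ∮ x in C(0, r), h x * (deriv g x / g x) = (2 * Real.pi * I) * (s.map h).sum := by
  have hfin : {c ∈ Metric.closedBall (0 : ℂ) r | g c = 0}.Finite := by
    by_contra hinf
    obtain ⟨a, ha, hacc⟩ := Set.Infinite.exists_accPt_of_subset_isCompact hinf
      (isCompact_closedBall (0 : ℂ) r) (fun x hx => hx.1)
    have h0 : ∃ᶠ z in 𝓝[≠] a, g z = 0 := by
      rw [accPt_iff_frequently_nhdsNE] at hacc
      exact hacc.mono fun z hz => hz.2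
    have := hg.eqOn_zero_of_preconnected_of_frequently_eq_zero
      (convex_closedBall (0 : ℂ) r).isPreconnected ha h0
    have hmem : (r : ℂ) ∈ Metric.sphere (0 : ℂ) r := by simp [abs_of_pos hr]
    exact hne _ hmem (this (Metric.sphere_subset_closedBall hmem))
  induction hn : {c ∈ Metric.closedBall (0 : ℂ) r | g c = 0}.ncard using Nat.strong_induction_on
    generalizing g with
  | _ n ih =>
  by_cases hZ : ∃ c ∈ Metric.closedBall (0 : ℂ) r, g c = 0
  · obtain ⟨c, hc, hgc⟩ := hZ
    have hcb : c ∈ Metric.ball (0 : ℂ) r := by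
      rcases (Metric.mem_closedBall.1 hc).lt_or_eq with h | h
      · exact h
      · exact absurd hgc (hne c h)
    have hord : ¬ ∀ᶠ z in 𝓝 c, g z = 0 := fun h => by
      have := hg.eqOn_zero_of_preconnected_of_eventuallyEq_zero
        (convex_closedBall (0 : ℂ) r).isPreconnected hc h
      have hmem : (r : ℂ) ∈ Metric.sphere (0 : ℂ) r := by simp [abs_of_pos hr]
      exact hne _ hmem (this (Metric.sphere_subset_closedBall hmem))
    obtain ⟨m, u0, hu0, hu0c, heq⟩ := (hg c hc).exists_eventuallyEq_pow_smul_nonzero_iff.2 hord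
    have hm : m ≠ 0 := by
      rintro rfl
      have := heq.self_of_nhds
      simp at this
      exact hu0c (this ▸ hgc)
    classical
    set u : ℂ → ℂ := Function.update (fun x => g x / (x - c) ^ m) c (u0 c) with hu
    have huc : u c = u0 c := by simp [hu]
    have hux : ∀ x, x ≠ c → u x = g x / (x - c) ^ m := fun x hx => by simp [hu, hx]
    have hgu : ∀ x, g x = (x - c) ^ m * u x := fun x => by
      by_cases hx : x = c
      · subst hx; simp [hm, hgc]
      · rw [hux x hx, mul_div_cancel₀ _ (pow_ne_zero _ (sub_ne_zero.2 hx))]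
    have hua : AnalyticOnNhd ℂ u (Metric.closedBall 0 r) := fun x hx => by
      by_cases hxc : x = c
      · subst hxc
        refine hu0.congr ?_
        filter_upwards [heq] with z hz
        by_cases hzx : z = x
        · subst hzx; exact huc.symm
        · rw [hux z hzx, hz, smul_eq_mul, mul_div_cancel_left₀ _ (pow_ne_zero _ (sub_ne_zero.2 hzx))]
      · have : AnalyticAt ℂ (fun x => g x / (x - c) ^ m) x :=
          (hg x hx).div ((analyticAt_id.sub analyticAt_const).pow m) (pow_ne_zero _ (sub_ne_zero.2 hxc))
        refine this.congr ?_
        filter_upwards [isOpen_ne.mem_nhds hxc] with z hz using (hux z hz).symm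
    have hZu : {x ∈ Metric.closedBall (0 : ℂ) r | u x = 0} =
        {x ∈ Metric.closedBall (0 : ℂ) r | g x = 0} \ {c} := by
      ext x
      by_cases hx : x = c
      · subst hx; simp [huc, hu0c]
      · simp [hgu x, hx, sub_eq_zero]
    have hcm : c ∈ {x ∈ Metric.closedBall (0 : ℂ) r | g x = 0} := ⟨hc, hgc⟩
    have hune : ∀ x ∈ Metric.sphere (0 : ℂ) r, u x ≠ 0 := fun x hx h =>
      hne x hx (by rw [hgu, h, mul_zero])
    obtain ⟨s, hs, hsum⟩ := ih _ (by
      rw [← hn]; exact Set.ncard_sdiff_singleton_lt_of_mem hcm hfin) hua hune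
      (by rw [hZu]; exact hfin.sdiff) (by rw [hZu])
    refine ⟨Multiset.replicate m c + s, fun x => ?_, fun h hh => ?_⟩
    · rw [Multiset.mem_add, hs, Multiset.mem_replicate]
      constructor
      · rintro (⟨-, rfl⟩ | ⟨h1, h2⟩)
        · exact ⟨hcb, hgc⟩
        · exact ⟨h1, by rw [hgu, h2, mul_zero]⟩
      · rintro ⟨h1, h2⟩
        by_cases hx : x = c
        · exact Or.inl ⟨hm, hx⟩
        · refine Or.inr ⟨h1, ?_⟩
          rw [hux x hx, h2, zero_div]
    · have hsplit : ∀ x ∈ Metric.sphere (0 : ℂ) r, h x * (deriv g x / g x) =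
          m * ((x - c)⁻¹ • h x) + h x * (deriv u x / u x) := fun x hx => by
        have hxc : x - c ≠ 0 := sub_ne_zero.2 fun hh => by
          subst hh; exact hne _ hx hgc
        have hd : HasDerivAt g (m * (x - c) ^ (m - 1) * 1 * u x + (x - c) ^ m * deriv u x) x := by
          have h1 := (((hasDerivAt_id x).sub_const c).pow m).mul
            (hua x (Metric.sphere_subset_closedBall hx)).differentiableAt.hasDerivAt
          exact h1.congr_of_eventuallyEq (Filter.Eventually.of_forall hgu)
        rw [hd.deriv, hgu x]
        have hux0 := hune x hx
        obtain ⟨m', rfl⟩ := Nat.exists_eq_succ_of_ne_zero hm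
        simp only [Nat.succ_eq_add_one, Nat.add_sub_cancel, smul_eq_mul, pow_succ]
        field_simp
      have hi1 : CircleIntegrable (fun x => (m : ℂ) * ((x - c)⁻¹ • h x)) 0 r := by
        refine ContinuousOn.circleIntegrable hr.le ?_
        refine continuousOn_const.mul (ContinuousOn.smul (ContinuousOn.inv₀ (f := fun x => x - c) (by fun_prop) ?_)
          (hh.continuousOn.mono Metric.sphere_subset_closedBall))
        intro x hx
        exact sub_ne_zero.2 fun hh => by
          subst hh; exact hne _ hx hgc
      have hi2 : CircleIntegrable (fun x => h x * (deriv u x / u x)) 0 r := by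
        refine ContinuousOn.circleIntegrable hr.le ?_
        refine (hh.continuousOn.mono Metric.sphere_subset_closedBall).mul
          (ContinuousOn.div (hua.deriv.continuousOn.mono Metric.sphere_subset_closedBall)
            (hua.continuousOn.mono Metric.sphere_subset_closedBall) hune)
      rw [circleIntegral.integral_congr hr.le hsplit, circleIntegral.integral_add hi1 hi2,
        hsum h hh, circleIntegral.integral_const_mul, Multiset.map_add, Multiset.sum_add,
        circleIntegral_sub_inv_smul_of_differentiable_on_off_countable countable_empty hcb
          hh.continuousOn (fun x hx => (hh x (Metric.ball_subset_closedBall hx.1)).differentiableAt)]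
      simp
      ring
  · push Not at hZ
    refine ⟨0, fun c => ?_, fun h hh => ?_⟩
    · simp only [Multiset.notMem_zero, false_iff, not_and]
      exact fun hc => hZ c (Metric.ball_subset_closedBall hc)
    · have hq : AnalyticOnNhd ℂ (fun x => h x * (deriv g x / g x)) (Metric.closedBall 0 r) :=
        hh.mul (hg.deriv.div hg hZ)
      rw [Complex.circleIntegral_eq_zero_of_differentiable_on_off_countable hr.le countable_empty
        hq.continuousOn fun x hx => (hq x (Metric.ball_subset_closedBall hx.1)).differentiableAt]
      simp

/-- A function of `t` into `ℂᵈ` whose power sums are holomorphic has holomorphic product. -/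
theorem differentiableOn_prod_of_psum {d : ℕ} {T : Set ℂ} {v : ℂ → Fin d → ℂ}
    (h : ∀ n, DifferentiableOn ℂ (fun t => ∑ i, v t i ^ n) T) :
    DifferentiableOn ℂ (fun t => ∏ i, v t i) T := by
  have key : ∀ k, DifferentiableOn ℂ
      (fun t => MvPolynomial.aeval (v t) (MvPolynomial.esymm (Fin d) ℂ k)) T := by
    intro k
    induction k using Nat.strong_induction_on with
    | _ k ih =>
    rcases Nat.eq_zero_or_pos k with rfl | hk
    · simp [MvPolynomial.esymm_zero]
    have hN : ∀ t, MvPolynomial.aeval (v t) (MvPolynomial.esymm (Fin d) ℂ k) =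
        (k : ℂ)⁻¹ * ((-1) ^ (k + 1) * ∑ a ∈ Finset.HasAntidiagonal.antidiagonal k with a.1 < k,
          (-1) ^ a.1 * MvPolynomial.aeval (v t) (MvPolynomial.esymm (Fin d) ℂ a.1) *
            ∑ i, v t i ^ a.2) := fun t => by
      have := congrArg (MvPolynomial.aeval (v t)) (MvPolynomial.mul_esymm_eq_sum (Fin d) ℂ k)
      simp only [map_mul, map_natCast, map_pow, map_neg, map_one, map_sum, MvPolynomial.psum,
        MvPolynomial.aeval_X] at this
      rw [← this, inv_mul_cancel_left₀ (by exact_mod_cast hk.ne')]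
    simp only [hN]
    refine (DifferentiableOn.const_mul (DifferentiableOn.const_mul ?_ _) _)
    refine DifferentiableOn.fun_sum fun a ha => ?_
    exact ((ih a.1 (Finset.mem_filter.1 ha).2).const_mul _).mul (h a.2)
  convert key d using 2 with t
  simp [MvPolynomial.esymm]
  have : Finset.powersetCard d (Finset.univ : Finset (Fin d)) = {Finset.univ} := by
    have := Finset.powersetCard_self (Finset.univ : Finset (Fin d))
    rwa [Finset.card_fin] at this
  rw [this]; simp

/-- Common zeros of two holomorphic families persist along a connected parameter domain. -/
theorem exists_common_zero {g h : ℂ × ℂ → ℂ} {r : ℝ} {T : Set ℂ} {t0 : ℂ} (hr : 0 < r)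
    (hT : IsOpen T) (hTc : IsPreconnected T)
    (hg : AnalyticOnNhd ℂ g (Metric.closedBall 0 r ×ˢ T))
    (hh : AnalyticOnNhd ℂ h (Metric.closedBall 0 r ×ˢ T))
    (hne : ∀ x ∈ Metric.sphere (0 : ℂ) r, ∀ t ∈ T, g (x, t) ≠ 0) (ht0 : t0 ∈ T)
    (hz : ∀ᶠ t in 𝓝 t0, ∃ x ∈ Metric.ball (0 : ℂ) r, g (x, t) = 0 ∧ h (x, t) = 0) :
    ∀ t ∈ T, ∃ x ∈ Metric.ball (0 : ℂ) r, g (x, t) = 0 ∧ h (x, t) = 0 := by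
  have hsec : ∀ {f : ℂ × ℂ → ℂ}, AnalyticOnNhd ℂ f (Metric.closedBall 0 r ×ˢ T) → ∀ t ∈ T,
      AnalyticOnNhd ℂ (fun x => f (x, t)) (Metric.closedBall 0 r) := fun hf t ht x hx =>
    (hf (x, t) ⟨hx, ht⟩).comp_of_eq (analyticAt_id.prod analyticAt_const) rfl
  have hroots : ∀ t, ∃ s : Multiset ℂ, t ∈ T →
      (∀ c, c ∈ s ↔ c ∈ Metric.ball (0 : ℂ) r ∧ g (c, t) = 0) ∧
      ∀ f : ℂ → ℂ, AnalyticOnNhd ℂ f (Metric.closedBall 0 r) →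
        ∮ x in C(0, r), f x * (deriv (fun x => g (x, t)) x / g (x, t)) =
          (2 * Real.pi * I) * (s.map f).sum := fun t => by
    by_cases ht : t ∈ T
    · obtain ⟨s, hs⟩ := exists_multiset_circleIntegral_logDeriv hr (hsec hg t ht)
        (fun x hx => hne x hx t ht)
      exact ⟨s, fun _ => hs⟩
    · exact ⟨0, fun h => absurd h ht⟩
  choose s hs using hroots
  have hpi : (2 * Real.pi * I : ℂ) ≠ 0 := by simp [Real.pi_ne_zero]
  -- power sums are holomorphic
  have hp : ∀ n, DifferentiableOn ℂ (fun t => ((s t).map fun c => h (c, t) ^ n).sum) T := by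
    intro n
    have h1 : AnalyticOnNhd ℂ (fun z : ℂ × ℂ => h z ^ n * (fderiv ℂ g z (1, 0) / g z))
        (Metric.sphere 0 r ×ˢ T) := by
      have hsub : Metric.sphere (0 : ℂ) r ×ˢ T ⊆ Metric.closedBall 0 r ×ˢ T :=
        prod_mono Metric.sphere_subset_closedBall le_rfl
      refine ((hh.mono hsub).pow n).mul (AnalyticOnNhd.div ?_ (hg.mono hsub)
        fun z hz => hne z.1 hz.1 z.2 hz.2)
      exact fun z hz => ((ContinuousLinearMap.apply ℂ ℂ ((1 : ℂ), (0 : ℂ))).analyticAt _).comp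
        (hg.fderiv z (hsub hz))
    refine ((differentiableOn_circleIntegral hr hT h1).const_mul (2 * Real.pi * I : ℂ)⁻¹).congr
      fun t ht => ?_
    have h2 := (hs t ht).2 (fun c => h (c, t) ^ n) ((hsec hh t ht).pow n)
    rw [eq_inv_mul_iff_mul_eq₀ hpi, ← h2]
    refine circleIntegral.integral_congr hr.le fun x hx => ?_
    have h3 : HasDerivAt (fun x => (x, t)) ((1 : ℂ), (0 : ℂ)) x :=
      (hasDerivAt_id x).prodMk (hasDerivAt_const x t)
    have h4 := (hg (x, t) ⟨Metric.sphere_subset_closedBall hx, ht⟩).differentiableAt.hasFDerivAt.comp_hasDerivAt x h3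
    exact congrArg (fun c => h (x, t) ^ n * (c / g (x, t))) h4.deriv
  -- the number of roots is constant
  have hcard : ∀ t ∈ T, (s t).card = (s t0).card := by
    intro t ht
    refine hTc.constant (f := fun t => (s t).card) ?_ ht ht0
    have h1 : ContinuousOn (fun t => ((s t).card : ℂ)) T := by
      have := (hp 0).continuousOn
      simpa using this
    have h2 : ContinuousOn (fun t => ((s t).card : ℝ)) T := by
      have := continuous_re.comp_continuousOn h1
      simpa [Function.comp_def] using this
    exact Nat.isClosedEmbedding_coe_real.isEmbedding.continuousOn_iff.2 h2
  set d := (s t0).card with hd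
  have hv : ∀ t, ∃ v : Fin d → ℂ, t ∈ T → s t = Finset.univ.val.map v := fun t => by
    by_cases ht : t ∈ T
    · have hlen : (s t).toList.length = d := by rw [Multiset.length_toList, hcard t ht]
      refine ⟨fun i => (s t).toList.get (i.cast hlen.symm), fun _ => ?_⟩
      have h1 : ((List.finRange d).map fun i => (s t).toList.get (i.cast hlen.symm)) =
          (s t).toList := by
        apply List.ext_get
        · simp [hlen]
        · intro n h1 h2; simp
      conv_lhs => rw [← Multiset.coe_toList (s t), ← h1]
      rfl
    · exact ⟨0, fun h => absurd h ht⟩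
  choose v hv using hv
  have hprod : DifferentiableOn ℂ (fun t => ∏ i, h (v t i, t)) T := by
    refine differentiableOn_prod_of_psum (v := fun t i => h (v t i, t)) fun n => ?_
    refine (hp n).congr fun t ht => ?_
    rw [hv t ht, Multiset.map_map]; rfl
  have hiff : ∀ t ∈ T, (∏ i, h (v t i, t) = 0 ↔
      ∃ x ∈ Metric.ball (0 : ℂ) r, g (x, t) = 0 ∧ h (x, t) = 0) := fun t ht => by
    rw [Finset.prod_eq_zero_iff]
    constructor
    · rintro ⟨i, -, hi⟩
      have hmem : v t i ∈ s t := by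
        rw [hv t ht]; exact Multiset.mem_map_of_mem _ (Finset.mem_univ i)
      obtain ⟨h1, h2⟩ := ((hs t ht).1 _).1 hmem
      exact ⟨_, h1, h2, hi⟩
    · rintro ⟨x, h1, h2, h3⟩
      have hmem := ((hs t ht).1 x).2 ⟨h1, h2⟩
      rw [hv t ht, Multiset.mem_map] at hmem
      obtain ⟨i, -, rfl⟩ := hmem
      exact ⟨i, Finset.mem_univ i, h3⟩
  have han := hprod.analyticOnNhd hT
  have h0 : (fun t => ∏ i, h (v t i, t)) =ᶠ[𝓝 t0] 0 := by
    filter_upwards [hz, hT.mem_nhds ht0] with t h1 h2 using (hiff t h2).2 h1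
  intro t ht
  exact (hiff t ht).1 (han.eqOn_zero_of_preconnected_of_eventuallyEq_zero hTc ht0 h0 ht)

/-- A zero of a holomorphic function that is isolated in `x` persists for nearby parameters. -/
theorem eventually_exists_zero {F : ℂ × ℂ → ℂ} (hF : AnalyticAt ℂ F (0, 0)) (h0 : F (0, 0) = 0)
    (hne : ¬ ∀ᶠ x in 𝓝 (0 : ℂ), F (x, 0) = 0) {r : ℝ} (hr : 0 < r) :
    ∀ᶠ t in 𝓝 (0 : ℂ), ∃ x ∈ Metric.ball (0 : ℂ) r, F (x, t) = 0 := by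
  obtain ⟨a, ha, haF⟩ := Metric.eventually_nhds_iff_ball.1 hF.eventually_analyticAt
  have hsec0 : AnalyticAt ℂ (fun x => F (x, 0)) 0 :=
    hF.comp_of_eq (analyticAt_id.prod analyticAt_const) rfl
  have hev : ∀ᶠ x in 𝓝[≠] (0 : ℂ), F (x, 0) ≠ 0 :=
    hsec0.eventually_eq_zero_or_eventually_ne_zero.resolve_left hne
  obtain ⟨b, hb, hbF⟩ := Metric.mem_nhdsWithin_iff.1 hev
  set r' := min (min a b) r / 2 with hr'
  have hpos : 0 < min (min a b) r := lt_min (lt_min ha hb) hr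
  have hr'0 : 0 < r' := half_pos hpos
  have hlt : r' < min (min a b) r := half_lt_self hpos
  have hr'a : r' < a := hlt.trans_le ((min_le_left _ _).trans (min_le_left _ _))
  have hr'b : r' < b := hlt.trans_le ((min_le_left _ _).trans (min_le_right _ _))
  have hr'r : r' < r := hlt.trans_le (min_le_right _ _)
  have hcont : ContinuousOn F (Metric.closedBall 0 r') := fun z hz =>
    (haF z (Metric.closedBall_subset_ball hr'a hz)).continuousAt.continuousWithinAt
  have hne' : ∀ x ∈ Metric.sphere (0 : ℂ) r', F (x, 0) ≠ 0 := fun x hx => by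
    refine hbF ⟨Metric.sphere_subset_closedBall.trans (Metric.closedBall_subset_ball hr'b) hx, ?_⟩
    rintro rfl
    simp at hx; exact hr'0.ne hx
  obtain ⟨η, hη, hηF⟩ : ∃ η > 0, ∀ x ∈ Metric.sphere (0 : ℂ) r', η ≤ ‖F (x, 0)‖ := by
    have hc : ContinuousOn (fun x => ‖F (x, 0)‖) (Metric.sphere (0 : ℂ) r') := by
      refine (hcont.comp (by fun_prop : Continuous fun x : ℂ => (x, (0 : ℂ))).continuousOn ?_).norm
      intro x hx
      have := Metric.sphere_subset_closedBall hx
      simpa using this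
    obtain ⟨x0, hx0, hmin⟩ := (isCompact_sphere (0 : ℂ) r').exists_isMinOn
      ⟨(r' : ℂ), by simp [abs_of_pos hr'0]⟩ hc
    exact ⟨_, norm_pos_iff.2 (hne' x0 hx0), fun x hx => hmin hx⟩
  -- uniform continuity on the compact set
  have huc := (isCompact_closedBall (0 : ℂ × ℂ) r').uniformContinuousOn_of_continuous hcont
  obtain ⟨δ, hδ, hδF⟩ := Metric.uniformContinuousOn_iff.1 huc (η / 4) (by positivity)
  filter_upwards [Metric.ball_mem_nhds (0 : ℂ) (lt_min hδ hr'0)] with t ht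
  rw [mem_ball_zero_iff, lt_min_iff] at ht
  have hclose : ∀ x ∈ Metric.closedBall (0 : ℂ) r', ‖F (x, t) - F (x, 0)‖ < η / 4 := fun x hx => by
    rw [← dist_eq_norm]
    rw [mem_closedBall_zero_iff] at hx
    refine hδF (x, t) ?_ (x, 0) ?_ ?_
    · rw [mem_closedBall_zero_iff, Prod.norm_def]; exact max_le hx ht.2.le
    · rw [mem_closedBall_zero_iff, Prod.norm_def]; exact max_le hx (by simpa using hr'0.le)
    · simpa [Prod.dist_eq, hδ] using ht.1
  have h00 : ‖F (0, t)‖ < η / 4 := by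
    have := hclose 0 (by simp [hr'0.le]); rwa [h0, sub_zero] at this
  have hsph : ∀ x ∈ Metric.sphere (0 : ℂ) r', η / 2 ≤ ‖F (x, t) - F (0, t)‖ := fun x hx => by
    have h1 := hclose x (Metric.sphere_subset_closedBall hx)
    have h2 := hηF x hx
    have h3 : F (x, 0) = (F (x, t) - F (0, t)) - (F (x, t) - F (x, 0)) + F (0, t) := by ring
    have h4 : ‖F (x, 0)‖ ≤ ‖F (x, t) - F (0, t)‖ + ‖F (x, t) - F (x, 0)‖ + ‖F (0, t)‖ := by
      calc ‖F (x, 0)‖ = _ := congrArg norm h3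
        _ ≤ _ := norm_add_le _ _
        _ ≤ _ := by gcongr; exact norm_sub_le _ _
    linarith
  have hana : AnalyticOnNhd ℂ (fun x => F (x, t)) (Metric.closedBall 0 r') := fun x hx => by
    refine (haF (x, t) ?_).comp_of_eq (analyticAt_id.prod analyticAt_const) rfl
    rw [mem_closedBall_zero_iff] at hx
    rw [mem_ball_iff_norm, Prod.norm_def]
    simpa using ⟨hx.trans_lt hr'a, ht.2.trans hr'a⟩
  have hdc : DiffContOnCl ℂ (fun x => F (x, t)) (Metric.ball 0 r') := by
    refine DifferentiableOn.diffContOnCl ?_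
    rw [closure_ball _ hr'0.ne']
    exact hana.differentiableOn
  have hfreq : ∃ᶠ x in 𝓝 (0 : ℂ), F (x, t) ≠ F (0, t) := by
    rw [Filter.frequently_iff]
    by_contra hcon
    push Not at hcon
    obtain ⟨W, hW, hWF⟩ := hcon
    have hev : (fun x => F (x, t)) =ᶠ[𝓝 0] fun _ => F (0, t) := by
      filter_upwards [hW] with x hx using hWF x hx
    have := hana.eqOn_of_preconnected_of_eventuallyEq (g := fun _ => F (0, t)) analyticOnNhd_const
      (convex_closedBall (0 : ℂ) r').isPreconnected (by simp [hr'0.le] : (0 : ℂ) ∈ _) hev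
    have hmem : (r' : ℂ) ∈ Metric.sphere (0 : ℂ) r' := by simp [abs_of_pos hr'0]
    have h5 := this (Metric.sphere_subset_closedBall hmem)
    have h6 := hsph _ hmem
    simp only at h5
    rw [h5, sub_self, norm_zero] at h6
    linarith
  have := hdc.ball_subset_image_closedBall hr'0 hsph hfreq
  obtain ⟨x, hx, hx0⟩ := this (show (0 : ℂ) ∈ Metric.ball (F (0, t)) (η / 2 / 2) by
    rw [mem_ball_iff_norm, zero_sub, norm_neg]; linarith)
  exact ⟨x, Metric.closedBall_subset_ball hr'r hx, hx0⟩

theorem AnalyticAt.exists_implicit {E : Type*} [NormedAddCommGroup E] [NormedSpace ℂ E]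
    [CompleteSpace E] {F : E × ℂ → ℂ} {a : E} {b : ℂ} (hF : AnalyticAt ℂ F (a, b))
    (hd : fderiv ℂ F (a, b) (0, 1) ≠ 0) :
    ∃ τ : E → ℂ, AnalyticAt ℂ τ a ∧ τ a = b ∧ (∀ᶠ z in 𝓝 a, F (z, τ z) = F (a, b)) ∧
      ∀ᶠ v in 𝓝 (a, b), F v = F (a, b) ↔ τ v.1 = v.2 := by
  have cdf : ContDiffAt ℂ (⊤ : WithTop ℕ∞) F (a, b) := hF.contDiffAt
  have pn : (⊤ : WithTop ℕ∞) ≠ 0 := by simp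
  have if₂ : (fderiv ℂ F (a, b) ∘L .inr ℂ E ℂ).IsInvertible := by
    set L := fderiv ℂ F (a, b) ∘L .inr ℂ E ℂ with hL
    have h1 : L 1 ≠ 0 := by simpa [hL] using hd
    refine ⟨ContinuousLinearEquiv.unitsEquivAut ℂ (Units.mk0 _ h1), ?_⟩
    ext
    simp
  refine ⟨cdf.implicitFunction pn if₂, (cdf.contDiffAt_implicitFunction pn if₂).analyticAt,
    cdf.implicitFunction_apply_self pn if₂, cdf.eventually_apply_implicitFunction pn if₂,
    cdf.eventually_apply_eq_iff_implicitFunction pn if₂⟩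

theorem AnalyticAt.eventually_eq_zero_of_star {N : ℕ} {S : CN N × CN N → ℂ} {q : CN N}
    (hS : AnalyticAt ℂ S (q, star q)) (h0 : ∀ᶠ z in 𝓝 q, S (z, star z) = 0) :
    ∀ᶠ u in 𝓝 (q, star q), S u = 0 := by
  obtain ⟨O, hO, hOan⟩ := hS.exists_mem_nhds_analyticOnNhd
  obtain ⟨W, hW, hWo, hqW⟩ := eventually_nhds_iff.1 h0
  let V : Set (CN N × CN N) := interior O ∩ Prod.fst ⁻¹' W
  have hV : IsOpen V := isOpen_interior.inter (hWo.preimage continuous_fst)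
  let A : Set (CN N × CN N) := Set.range fun z => (z, star z)
  refine AnalyticOnNhd.eventuallyEq_zero_of_span_tangentConeAt (V := V) (A := A)
    (hOan.mono fun x hx => interior_subset hx.1) hV ?_ ?_
    ⟨mem_range_self q, mem_interior_iff_mem_nhds.2 hO, hqW⟩
  · rintro _ ⟨⟨z, rfl⟩, -⟩
    have hT : ∀ v : CN N, (v, star v) ∈ tangentConeAt ℝ A (z, star z) := by
      intro v
      let L : CN N →L[ℝ] CN N × CN N :=
        (ContinuousLinearMap.id ℝ (CN N)).prod (starL' ℝ : CN N ≃L[ℝ] CN N)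
      have hL : HasFDerivWithinAt (fun z : CN N => (z, star z)) L univ z :=
        L.hasFDerivAt.hasFDerivWithinAt
      have := hL.mapsTo_tangent_cone (by simp [tangentConeAt_univ] : v ∈ tangentConeAt ℝ univ z)
      rwa [image_univ] at this
    set Sp := Submodule.span ℂ (tangentConeAt ℝ A (z, star z)) with hSp
    have h1 : ∀ v : CN N, ((v, 0) : CN N × CN N) ∈ Sp := by
      intro v
      have ha := Submodule.subset_span (R := ℂ) (hT v)
      have hb := Submodule.subset_span (R := ℂ) (hT (I • v))
      have := Sp.smul_mem (1 / 2 : ℂ) (Sp.sub_mem ha (Sp.smul_mem I hb))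
      convert this using 1
      ext i
      · simp only [Prod.smul_fst, Prod.fst_sub, Pi.smul_apply, Pi.sub_apply, smul_eq_mul]
        linear_combination (v i / 2) * I_sq
      · simp only [Prod.smul_snd, Prod.snd_sub, Pi.smul_apply, Pi.sub_apply, smul_eq_mul,
          Pi.star_apply, star_smul, RCLike.star_def, conj_I, Pi.zero_apply]
        linear_combination (-(starRingEnd ℂ (v i)) / 2) * I_sq
    have h2 : ∀ v : CN N, ((0, v) : CN N × CN N) ∈ Sp := by
      intro v
      have ha := Submodule.subset_span (R := ℂ) (hT (star v))
      have := Sp.sub_mem ha (h1 (star v))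
      simpa using this
    rw [eq_top_iff]
    rintro ⟨v, w⟩ -
    simpa using Sp.add_mem (h1 v) (h2 w)
  · rintro _ ⟨⟨z, rfl⟩, -, hz⟩
    exact hW z hz

/-- A real-analytic function vanishing on a leaf `{f = f q}` has a complexification vanishing on
the product of the leaf with its conjugate. -/
theorem AnalyticAt.exists_nhds_eq_zero_on_leaf {N : ℕ} {f : CN N → ℂ} {R : CN N × CN N → ℂ}
    {q : CN N} (hf : AnalyticAt ℂ f q) (hdf : fderiv ℂ f q ≠ 0)
    (hR : AnalyticAt ℂ R (q, star q))
    (h0 : ∀ᶠ z in 𝓝 q, f z = f q → R (z, star z) = 0) :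
    ∃ W ∈ 𝓝 q, ∀ z ∈ W, ∀ w ∈ W, f z = f q → f w = f q → R (z, star w) = 0 := by
  obtain ⟨v, hv⟩ : ∃ v, fderiv ℂ f q v ≠ 0 := by
    by_contra! h
    exact hdf (ContinuousLinearMap.ext h)
  have hadd : AnalyticAt ℂ (fun u : CN N × ℂ => u.1 + u.2 • v) (q, 0) :=
    analyticAt_fst.add (analyticAt_snd.smul analyticAt_const)
  have hF : AnalyticAt ℂ (fun u : CN N × ℂ => f (u.1 + u.2 • v)) (q, 0) :=
    AnalyticAt.comp_of_eq hf hadd (by simp)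
  have hFd : fderiv ℂ (fun u : CN N × ℂ => f (u.1 + u.2 • v)) (q, 0) (0, 1) = fderiv ℂ f q v := by
    have h1 : HasFDerivAt (fun u : CN N × ℂ => u.1 + u.2 • v)
        (ContinuousLinearMap.fst ℂ (CN N) ℂ +
          (ContinuousLinearMap.snd ℂ (CN N) ℂ).smulRight v) (q, 0) :=
      (ContinuousLinearMap.fst ℂ (CN N) ℂ +
        (ContinuousLinearMap.snd ℂ (CN N) ℂ).smulRight v).hasFDerivAt
    have h2 : HasFDerivAt f (fderiv ℂ f q) ((q, (0 : ℂ)).1 + (q, (0 : ℂ)).2 • v) := by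
      simpa using hf.differentiableAt.hasFDerivAt
    have h3 : HasFDerivAt (fun u : CN N × ℂ => f (u.1 + u.2 • v)) _ (q, 0) := h2.comp (q, 0) h1
    rw [h3.fderiv]
    simp
  obtain ⟨τ, hτ, hτq, hτ1, hτ2⟩ := hF.exists_implicit (by rwa [hFd])
  simp only [zero_smul, add_zero] at hτ1 hτ2
  let γ : CN N → CN N := fun z => z + τ z • v
  have hγ : AnalyticAt ℂ γ q := analyticAt_id.add (hτ.smul analyticAt_const)
  have hγq : γ q = q := by simp [γ, hτq]
  have hγ' : AnalyticAt ℂ (fun w => star (γ (star w))) (star q) :=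
    AnalyticAt.star_star (by simpa using hγ)
  let S : CN N × CN N → ℂ := fun u => R (γ u.1, star (γ (star u.2)))
  have hS : AnalyticAt ℂ S (q, star q) := by
    refine AnalyticAt.comp_of_eq hR
      (AnalyticAt.prod (AnalyticAt.comp_of_eq hγ analyticAt_fst rfl)
        (AnalyticAt.comp_of_eq (g := fun w => star (γ (star w))) hγ' analyticAt_snd rfl)) ?_
    simp [hγq]
  have hS0 : ∀ᶠ z in 𝓝 q, S (z, star z) = 0 := by
    have hc : Tendsto γ (𝓝 q) (𝓝 q) := by
      simpa [hγq] using hγ.continuousAt.tendsto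
    filter_upwards [hc.eventually h0, hτ1] with z h1 h2
    simpa [S] using h1 h2
  have hS1 := hS.eventually_eq_zero_of_star hS0
  have hfix : ∀ᶠ z in 𝓝 q, f z = f q → γ z = z := by
    have hc : Tendsto (fun z : CN N => (z, (0 : ℂ))) (𝓝 q) (𝓝 (q, 0)) :=
      (continuous_id.prodMk continuous_const).tendsto q
    filter_upwards [hc.eventually hτ2] with z h1 h2
    simp only [zero_smul, add_zero] at h1
    simp [γ, h1.1 h2]
  have hS2 : ∀ᶠ u in 𝓝 (q, q), S (u.1, star u.2) = 0 := by
    have hc : Tendsto (fun u : CN N × CN N => (u.1, star u.2)) (𝓝 (q, q)) (𝓝 (q, star q)) :=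
      (continuous_fst.prodMk (continuous_snd.star)).tendsto (q, q)
    exact hc.eventually hS1
  rw [nhds_prod_eq] at hS2
  obtain ⟨t, ht, hS3⟩ := (eventually_prod_self_iff (r := fun a b => S (a, star b) = 0)).1 hS2
  refine ⟨t ∩ {z | f z = f q → γ z = z}, inter_mem ht hfix, fun z hz w hw hfz hfw => ?_⟩
  have := hS3 z hz.1 w hw.1
  simpa [S, hz.2 hfz, hw.2 hfw] using this

/-- Functions holomorphic on `B` which vanish on the germ at `q` of the leaf `{f = f q}`. -/
def leafIdeal {N : ℕ} (B : Set (CN N)) (f : CN N → ℂ) (q : CN N) : Submodule ℂ (CN N → ℂ) where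
  carrier := {h | AnalyticOnNhd ℂ h B ∧ ∀ᶠ z in 𝓝 q, f z = f q → h z = 0}
  add_mem' := by
    rintro g h ⟨hg, hg0⟩ ⟨hh, hh0⟩
    refine ⟨hg.add hh, ?_⟩
    filter_upwards [hg0, hh0] with z h1 h2 h3
    simp [h1 h3, h2 h3]
  zero_mem' := ⟨analyticOnNhd_const, by simp⟩
  smul_mem' := by
    rintro c h ⟨hh, hh0⟩
    refine ⟨AnalyticOnNhd.smul (f := fun _ => c) analyticOnNhd_const hh, ?_⟩
    filter_upwards [hh0] with z h1 h2
    simp [h1 h2]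

theorem analyticAt_star_snd {N : ℕ} {R : CN N × CN N → ℂ} {z w : CN N}
    (hR : AnalyticAt ℂ R (z, w)) : AnalyticAt ℂ (fun z => R (z, w)) z :=
  AnalyticAt.comp_of_eq hR (analyticAt_id.prod analyticAt_const) rfl

theorem star_mem_ball {N : ℕ} {p z : CN N} {ε : ℝ} (h : z ∈ Metric.ball p ε) :
    star z ∈ Metric.ball (star p) ε := by
  rw [mem_ball_iff_norm] at h ⊢
  rwa [← star_sub, norm_star]

/-- The leaf of a Levi-flat hypersurface through `q`, followed along the lines in direction `e`,
produces a point of the real-analytic set `{R(z, z̄) = 0}` on the line through `b`, on the Segre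
variety of `q`. -/
theorem exists_mem_segre_line {N : ℕ} {p0 q b e : CN N} {ε r : ℝ} {R : CN N × CN N → ℂ}
    {f : CN N → ℂ} (hr : 0 < r)
    (hR : AnalyticOnNhd ℂ R (Metric.ball p0 ε ×ˢ Metric.ball (star p0) ε))
    (hsym : ∀ z w, R (star w, star z) = star (R (z, w)))
    (hq : q ∈ Metric.ball p0 ε) (hf : AnalyticAt ℂ f q) (hdf : fderiv ℂ f q ≠ 0)
    (hleaf : ∀ᶠ z in 𝓝 q, f z = f q → R (z, star z) = 0)
    (hin : ∀ t ∈ Metric.ball (0 : ℂ) 2, ∀ x ∈ Metric.closedBall (0 : ℂ) r,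
      q + t • (b - q) + x • e ∈ Metric.ball p0 ε)
    (hne : ∀ t ∈ Metric.ball (0 : ℂ) 2, ∀ x ∈ Metric.sphere (0 : ℂ) r,
      R (q + t • (b - q) + x • e, star q) ≠ 0) :
    ∃ x ∈ Metric.ball (0 : ℂ) r, R (b + x • e, star q) = 0 ∧
      R (b + x • e, star (b + x • e)) = 0 := by
  have hqs := star_mem_ball hq
  obtain ⟨W, hW, hWR⟩ := hf.exists_nhds_eq_zero_on_leaf hdf (hR _ ⟨hq, hqs⟩) hleaf
  let B := Metric.ball p0 ε
  let l : ℂ × ℂ → CN N := fun u => q + u.2 • (b - q) + u.1 • e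
  have hl : ∀ u, AnalyticAt ℂ l u := fun u =>
    (analyticAt_const.add (analyticAt_snd.smul analyticAt_const)).add
      (analyticAt_fst.smul analyticAt_const)
  have hmem : ∀ w ∈ W ∩ B, f w = f q → (fun z => R (z, star w)) ∈ leafIdeal B f q := by
    intro w hw hfw
    refine ⟨fun z hz => analyticAt_star_snd (hR _ ⟨hz, star_mem_ball hw.2⟩), ?_⟩
    filter_upwards [hW] with z hz hfz
    exact hWR z hz w hw.1 hfz hfw
  have hqW : q ∈ W ∩ B := ⟨mem_of_mem_nhds hW, hq⟩
  let g : ℂ × ℂ → ℂ := fun u => R (l u, star q)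
  have hcomp : ∀ h : CN N → ℂ, AnalyticOnNhd ℂ h B → AnalyticOnNhd ℂ (fun u => h (l u))
      (Metric.closedBall 0 r ×ˢ Metric.ball 0 2) := fun h hh u hu =>
    AnalyticAt.comp_of_eq (hh _ (hin _ hu.2 _ hu.1)) (hl u) rfl
  have hg : AnalyticOnNhd ℂ g (Metric.closedBall 0 r ×ˢ Metric.ball 0 2) :=
    hcomp _ (hmem q hqW rfl).1
  have h02 : (0 : ℂ) ∈ Metric.ball (0 : ℂ) 2 := by simp
  have h12 : (1 : ℂ) ∈ Metric.ball (0 : ℂ) 2 := by simp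
  have hslice : ∀ t ∈ Metric.ball (0 : ℂ) 2,
      AnalyticOnNhd ℂ (fun x => g (x, t)) (Metric.closedBall 0 r) := fun t ht x hx =>
    AnalyticAt.comp_of_eq (g := g) (hg (x, t) ⟨hx, ht⟩) (analyticAt_id.prod analyticAt_const) rfl
  have hl0 : l (0, 0) = q := by simp [l]
  have hlc : Tendsto l (𝓝 (0, 0)) (𝓝 q) := by
    have := (hl (0, 0)).continuousAt.tendsto
    rwa [hl0] at this
  -- common zeros on the line through `b`, for each function in the ideal
  have hzero : ∀ h ∈ leafIdeal B f q, ∃ x ∈ Metric.ball (0 : ℂ) r,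
      g (x, 1) = 0 ∧ h (l (x, 1)) = 0 := by
    intro h hh
    refine exists_common_zero (T := Metric.ball 0 2) (t0 := 0) (h := fun u => h (l u)) hr
      Metric.isOpen_ball (convex_ball _ _).isPreconnected hg (hcomp h hh.1)
      (fun x hx t ht => hne t ht x hx) h02 ?_ 1 h12
    have hev : ∀ᶠ u in 𝓝 ((0 : ℂ), (0 : ℂ)), f (l u) = f q → g u = 0 ∧ h (l u) = 0 := by
      filter_upwards [hlc.eventually hh.2, hlc.eventually (hmem q hqW rfl).2] with u h1 h2 h3
      exact ⟨h2 h3, h1 h3⟩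
    obtain ⟨δ, hδ, hδ'⟩ := Metric.eventually_nhds_iff_ball.1 hev
    have hF : AnalyticAt ℂ (fun u => f (l u) - f q) ((0 : ℂ), (0 : ℂ)) :=
      (AnalyticAt.comp_of_eq hf (hl _) hl0).sub analyticAt_const
    have hFne : ¬ ∀ᶠ x in 𝓝 (0 : ℂ), f (l (x, 0)) - f q = 0 := by
      intro hF0
      have hc : Tendsto (fun x : ℂ => (x, (0 : ℂ))) (𝓝 0) (𝓝 (0, 0)) :=
        (continuous_id.prodMk continuous_const).tendsto 0
      have h1 : (fun x => g (x, 0)) =ᶠ[𝓝 0] 0 := by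
        filter_upwards [hF0, hc.eventually hev] with x h1 h2
        exact (h2 (sub_eq_zero.1 h1)).1
      have h2 := (hslice 0 h02).eqOn_zero_of_preconnected_of_eventuallyEq_zero
        (convex_closedBall _ _).isPreconnected (by simp [hr.le]) h1
      have hrs : (r : ℂ) ∈ Metric.sphere (0 : ℂ) r := by simp [abs_of_pos hr]
      exact hne 0 h02 r hrs (h2 (Metric.sphere_subset_closedBall hrs))
    have := eventually_exists_zero hF (by simp [hl0]) hFne (lt_min hr hδ)
    filter_upwards [this, Metric.ball_mem_nhds 0 hδ] with t ⟨x, hx, hxt⟩ ht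
    have hxr := Metric.ball_subset_ball (min_le_left _ _) hx
    have hxδ := Metric.ball_subset_ball (min_le_right _ _) hx
    exact ⟨x, hxr, hδ' (x, t) (by rw [← ball_prod_same]; exact ⟨hxδ, ht⟩) (sub_eq_zero.1 hxt)⟩
  obtain ⟨s, hs, -⟩ := exists_multiset_circleIntegral_logDeriv hr (hslice 1 h12)
    (fun x hx => hne 1 h12 x hx)
  let p : s.toFinset → Submodule ℂ (leafIdeal B f q) := fun c =>
    LinearMap.ker ((LinearMap.proj (l (c, 1)) : (CN N → ℂ) →ₗ[ℂ] ℂ) ∘ₗ (leafIdeal B f q).subtype)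
  have hcov : ⋃ c, (p c : Set (leafIdeal B f q)) = univ := by
    refine eq_univ_of_forall fun h => ?_
    obtain ⟨x, hx, hx1, hx2⟩ := hzero h h.2
    exact mem_iUnion.2 ⟨⟨x, Multiset.mem_toFinset.2 ((hs x).2 ⟨hx, hx1⟩)⟩, hx2⟩
  obtain ⟨⟨c, hc⟩, hctop⟩ := Subspace.exists_eq_top_of_iUnion_eq_univ hcov
  obtain ⟨hcr, hcg⟩ := (hs c).1 (Multiset.mem_toFinset.1 hc)
  have hP : l (c, 1) = b + c • e := by simp [l]
  have hPB : b + c • e ∈ B := by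
    rw [← hP]; exact hin 1 h12 c (Metric.ball_subset_closedBall hcr)
  have hall : ∀ h ∈ leafIdeal B f q, h (b + c • e) = 0 := by
    intro h hh
    have : (⟨h, hh⟩ : leafIdeal B f q) ∈ p ⟨c, hc⟩ := by rw [hctop]; trivial
    rw [← hP]
    exact this
  refine ⟨c, hcr, hall _ (hmem q hqW rfl), hall (fun w => R (w, star (b + c • e))) ⟨fun z hz =>
    analyticAt_star_snd (hR _ ⟨hz, star_mem_ball hPB⟩), ?_⟩⟩
  filter_upwards [hW, Metric.isOpen_ball.mem_nhds hq] with w hw hwB hfw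
  have h1 := hall _ (hmem w ⟨hw, hwB⟩ hfw)
  have h2 := hsym (b + c • e) (star w)
  rw [h1] at h2
  simpa using h2

/-- Iterated partial derivatives in the last variable. -/
def lastDeriv {E : Type*} [NormedAddCommGroup E] [NormedSpace ℂ E] (G : E × ℂ → ℂ) :
    ℕ → E × ℂ → ℂ
  | 0 => G
  | j + 1 => fun u => fderiv ℂ (lastDeriv G j) u (0, 1)

section

variable {E : Type*} [NormedAddCommGroup E] [NormedSpace ℂ E] {G : E × ℂ → ℂ}

theorem AnalyticAt.analyticAt_lastDeriv {u : E × ℂ} (hG : AnalyticAt ℂ G u) (j : ℕ) :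
    AnalyticAt ℂ (lastDeriv G j) u := by
  induction j with
  | zero => exact hG
  | succ j ih => exact ((ContinuousLinearMap.apply ℂ ℂ ((0 : E), (1 : ℂ))).analyticAt _).comp ih.fderiv

theorem AnalyticAt.iteratedDeriv_slice (j : ℕ) : ∀ {u : E × ℂ}, AnalyticAt ℂ G u →
    iteratedDeriv j (fun x => G (u.1, x)) u.2 = lastDeriv G j u := by
  induction j with
  | zero => intro u _; simp [lastDeriv]
  | succ j ih =>
    intro u hG
    rw [iteratedDeriv_succ]
    have hc : Tendsto (fun x => (u.1, x)) (𝓝 u.2) (𝓝 u) :=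
      (continuous_const.prodMk continuous_id).tendsto u.2
    have h1 : iteratedDeriv j (fun x => G (u.1, x)) =ᶠ[𝓝 u.2]
        fun x => lastDeriv G j (u.1, x) := by
      filter_upwards [hc.eventually hG.eventually_analyticAt] with x hx
      exact ih hx
    rw [h1.deriv_eq]
    have h2 : HasFDerivAt (lastDeriv G j) (fderiv ℂ (lastDeriv G j) u) (u.1, u.2) :=
      (hG.analyticAt_lastDeriv j).differentiableAt.hasFDerivAt
    have h3 : HasDerivAt (fun x : ℂ => (u.1, x)) ((0 : E), (1 : ℂ)) u.2 :=
      (hasDerivAt_const _ _).prodMk (hasDerivAt_id _)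
    exact (h2.comp_hasDerivAt u.2 h3).deriv

theorem AnalyticAt.exists_lastDeriv_ne_zero {u : E × ℂ} (hG : AnalyticAt ℂ G u)
    (h : ¬ ∀ᶠ x in 𝓝 u.2, G (u.1, x) = 0) : ∃ j, lastDeriv G j u ≠ 0 := by
  by_contra! h0
  have hs : AnalyticAt ℂ (fun x => G (u.1, x)) u.2 :=
    AnalyticAt.comp_of_eq hG (analyticAt_const.prod analyticAt_id) rfl
  refine h ?_
  have := hs.hasFPowerSeriesAt
  simp only [hG.iteratedDeriv_slice, h0] at this
  have h2 := this.eventually_hasSum_sub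
  filter_upwards [h2] with x hx
  refine hx.unique ?_
  simp [FormalMultilinearSeries.ofScalars]

variable [CompleteSpace E]

theorem exists_analyticAt_selection {M : Set E} {K : Set ℂ} (hK : IsCompact K)
    (hG : ∀ q ∈ M, ∀ x ∈ K, AnalyticAt ℂ G (q, x)) (h0 : ∀ q ∈ M, ∃ x ∈ K, G (q, x) = 0)
    {p : E} (hp : p ∈ M) (hne : ∀ x ∈ K, ¬ ∀ᶠ y in 𝓝 x, G (p, y) = 0) :
    ∃ q ∈ M, ∃ k : E → ℂ, AnalyticAt ℂ k q ∧ ∀ᶠ z in 𝓝[M] q, k z ∈ K ∧ G (z, k z) = 0 := by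
  by_contra! hcon
  have hcont : ∀ q ∈ M, ∀ x ∈ K, ∀ j, ContinuousAt (lastDeriv G j) (q, x) := fun q hq x hx j =>
    ((hG q hq x hx).analyticAt_lastDeriv j).continuousAt
  have key : ∀ s : ℕ, ∀ W : Set E, IsOpen W → (M ∩ W).Nonempty →
      ∃ q ∈ M ∩ W, ∃ x ∈ K, ∀ j < s + 1, lastDeriv G j (q, x) = 0 := by
    intro s
    induction s with
    | zero =>
      rintro W - ⟨q, hq⟩
      obtain ⟨x, hx, hqx⟩ := h0 q hq.1
      exact ⟨q, hq, x, hx, fun j hj => by rwa [Nat.lt_one_iff.1 hj]⟩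
    | succ s ih =>
      rintro W hW ⟨q0, hq0⟩
      by_contra! hno
      have hPK : ∃ W1, IsOpen W1 ∧ q0 ∈ W1 ∧ ∀ W' ⊆ W1, IsOpen W' → (M ∩ W').Nonempty →
          ∃ W'' ⊆ W', IsOpen W'' ∧ (M ∩ W'').Nonempty ∧
            ∀ q ∈ M ∩ W'', ∀ x ∈ K, ∃ j < s + 1, lastDeriv G j (q, x) ≠ 0 := by
        refine hK.induction_on (p := fun S => ∃ W1, IsOpen W1 ∧ q0 ∈ W1 ∧
          ∀ W' ⊆ W1, IsOpen W' → (M ∩ W').Nonempty → ∃ W'' ⊆ W', IsOpen W'' ∧ (M ∩ W'').Nonempty ∧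
            ∀ q ∈ M ∩ W'', ∀ x ∈ S, ∃ j < s + 1, lastDeriv G j (q, x) ≠ 0) ?_ ?_ ?_ ?_
        · exact ⟨univ, isOpen_univ, trivial, fun W' _ ho hn => ⟨W', subset_rfl, ho, hn, by simp⟩⟩
        · rintro S T hST ⟨W1, ho, hq, h⟩
          refine ⟨W1, ho, hq, fun W' hW' ho' hn => ?_⟩
          obtain ⟨W'', h1, h2, h3, h4⟩ := h W' hW' ho' hn
          exact ⟨W'', h1, h2, h3, fun q hq x hx => h4 q hq x (hST hx)⟩
        · rintro S T ⟨W1, ho1, hq1, h1⟩ ⟨W2, ho2, hq2, h2⟩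
          refine ⟨W1 ∩ W2, ho1.inter ho2, ⟨hq1, hq2⟩, fun W' hW' ho' hn => ?_⟩
          obtain ⟨W3, a1, a2, a3, a4⟩ := h1 W' (hW'.trans inter_subset_left) ho' hn
          obtain ⟨W4, b1, b2, b3, b4⟩ := h2 W3 ((a1.trans hW').trans inter_subset_right) a2 a3
          refine ⟨W4, b1.trans a1, b2, b3, fun q hq x hx => ?_⟩
          exact hx.elim (fun hx => a4 q ⟨hq.1, b1 hq.2⟩ x hx) (fun hx => b4 q hq x hx)
        · intro x0 hx0
          obtain ⟨j, hj, hj0⟩ := hno q0 hq0 x0 hx0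
          by_cases hZ : ∃ j < s + 1, lastDeriv G j (q0, x0) ≠ 0
          · obtain ⟨j, hj, hj0⟩ := hZ
            have hev := (hcont q0 hq0.1 x0 hx0 j).eventually_ne hj0
            rw [nhds_prod_eq] at hev
            obtain ⟨A, hA, B, hB, hAB⟩ := mem_prod_iff.1 hev
            obtain ⟨W1, hW1A, hW1o, hqW1⟩ := mem_nhds_iff.1 hA
            refine ⟨B, mem_nhdsWithin_of_mem_nhds hB, W1, hW1o, hqW1, fun W' hW' ho' hn =>
              ⟨W', subset_rfl, ho', hn, fun q hq x hx => ⟨j, hj, ?_⟩⟩⟩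
            exact hAB ⟨hW1A (hW' hq.2), hx⟩
          · push Not at hZ
            have hjs : j = s + 1 := by
              by_contra hne
              exact hj0 (hZ j (by omega))
            subst hjs
            obtain ⟨k, hk, hk0, -, hk2⟩ := ((hG q0 hq0.1 x0 hx0).analyticAt_lastDeriv s).exists_implicit hj0
            rw [hZ s (Nat.lt_succ_self s), nhds_prod_eq] at hk2
            obtain ⟨A, hA, B, hB, hAB⟩ := mem_prod_iff.1 hk2
            obtain ⟨W1, hW1A, hW1o, hqW1⟩ := mem_nhds_iff.1 (inter_mem hA hk.eventually_analyticAt)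
            refine ⟨B ∩ K, inter_mem (mem_nhdsWithin_of_mem_nhds hB) self_mem_nhdsWithin, W1, hW1o,
              hqW1, ?_⟩
            rintro W' hW' ho' ⟨q1, hq1M, hq1W⟩
            have hkq1 : AnalyticAt ℂ k q1 := (hW1A (hW' hq1W)).2
            have hex := hcon q1 hq1M k hkq1
            have hex2 := hex.and_eventually (inter_mem self_mem_nhdsWithin
              (mem_nhdsWithin_of_mem_nhds (ho'.mem_nhds hq1W)))
            obtain ⟨q2, hq2, hq2M, hq2W⟩ := hex2.exists
            have hkq2 : AnalyticAt ℂ k q2 := (hW1A (hW' hq2W)).2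
            have hbad : ∀ᶠ q in 𝓝 q2, k q ∈ K → G (q, k q) ≠ 0 := by
              by_cases hkK : k q2 ∈ K
              · have hc : ContinuousAt (fun q => G (q, k q)) q2 :=
                  ContinuousAt.comp_of_eq (g := G) (hcont q2 hq2M _ hkK 0)
                    (continuousAt_id.prodMk hkq2.continuousAt) rfl
                filter_upwards [hc.eventually_ne (hq2 hkK)] with q hq _
                exact hq
              · filter_upwards [hkq2.continuousAt.eventually
                  (hK.isClosed.isOpen_compl.mem_nhds hkK)] with q hq h
                exact absurd h hq
            obtain ⟨W2, hW2, hW2o, hqW2⟩ := eventually_nhds_iff.1 hbad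
            refine ⟨W' ∩ W2, inter_subset_left, ho'.inter hW2o, ⟨q2, hq2M, hq2W, hqW2⟩, ?_⟩
            rintro q ⟨hqM, hqW', hqW2'⟩ x ⟨hxB, hxK⟩
            by_contra! hall
            have hkx : k q = x :=
              (hAB (⟨(hW1A (hW' hqW')).1, hxB⟩ : (q, x) ∈ A ×ˢ B)).1 (hall s (Nat.lt_succ_self s))
            refine hW2 q hqW2' (hkx ▸ hxK) ?_
            rw [hkx]
            exact hall 0 (Nat.succ_pos s)
      obtain ⟨W1, hW1o, hqW1, h1⟩ := hPK
      obtain ⟨W2, -, hW2o, hne2, h2⟩ := h1 W1 subset_rfl hW1o ⟨q0, hq0.1, hqW1⟩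
      obtain ⟨q, hq, x, hx, hqx⟩ := ih W2 hW2o hne2
      obtain ⟨j, hj, hj0⟩ := h2 q hq x hx
      exact hj0 (hqx j hj)
  have hfin : ∃ s, ∀ᶠ q in 𝓝 p, ∀ x ∈ K, ∃ j < s + 1, lastDeriv G j (q, x) ≠ 0 := by
    refine hK.induction_on (p := fun S => ∃ s, ∀ᶠ q in 𝓝 p, ∀ x ∈ S,
      ∃ j < s + 1, lastDeriv G j (q, x) ≠ 0) ⟨0, by simp⟩ ?_ ?_ ?_
    · rintro S T hST ⟨s, hs⟩
      exact ⟨s, hs.mono fun q hq x hx => hq x (hST hx)⟩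
    · rintro S T ⟨s, hs⟩ ⟨t, ht⟩
      refine ⟨max s t, ?_⟩
      filter_upwards [hs, ht] with q h1 h2 x hx
      rcases hx with hx | hx
      · obtain ⟨j, hj, h⟩ := h1 x hx
        exact ⟨j, by omega, h⟩
      · obtain ⟨j, hj, h⟩ := h2 x hx
        exact ⟨j, by omega, h⟩
    · intro x hx
      obtain ⟨j, hj⟩ := (hG p hp x hx).exists_lastDeriv_ne_zero (hne x hx)
      have hev := (hcont p hp x hx j).eventually_ne hj
      rw [nhds_prod_eq] at hev
      obtain ⟨A, hA, B, hB, hAB⟩ := mem_prod_iff.1 hev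
      refine ⟨B, mem_nhdsWithin_of_mem_nhds hB, j, ?_⟩
      filter_upwards [hA] with q hq y hy
      exact ⟨j, Nat.lt_succ_self j, hAB ⟨hq, hy⟩⟩
  obtain ⟨s, hs⟩ := hfin
  obtain ⟨W, hW, hWo, hpW⟩ := eventually_nhds_iff.1 hs
  obtain ⟨q, hq, x, hx, hqx⟩ := key s W hWo ⟨p, hp, hpW⟩
  obtain ⟨j, hj, hj0⟩ := hW q hq.2 x hx
  exact hj0 (hqx j hj)

end

section

variable {N κ : ℕ} {M V : Set (CN N)} {r : Fin κ → CN N → ℝ} {q : CN N} {k : CN N → ℂ}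

/-- The image of a real submanifold under a holomorphic function is a neighborhood as soon as the
function is not constant in complex tangential directions. -/
theorem image_mem_nhds_of_crTangent (hV : IsOpen V) (hX : M ∩ V = {z ∈ V | ∀ i, r i z = 0})
    (hq : q ∈ M ∩ V) (hr : ∀ i, AnalyticAt ℝ (r i) q)
    (hind : LinearIndependent ℝ fun i => fderiv ℝ (r i) q) (hk : AnalyticAt ℂ k q) {v : CN N}
    (hv : v ∈ crTangent N M q) (hkv : fderiv ℂ k q v ≠ 0) {W : Set (CN N)} (hW : W ∈ 𝓝 q) :
    k '' (M ∩ W) ∈ 𝓝 (k q) := by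
  have hT := tangentConeAt_eq_ker hV hX hq hr hind
  rw [crTangent, hT] at hv
  have hv1 : ∀ i, fderiv ℝ (r i) q v = 0 := hv.1
  have hv2 : ∀ i, fderiv ℝ (r i) q (I • v) = 0 := hv.2
  let F : CN N → (Fin κ → ℝ) × ℂ := fun z => (fun i => r i z, k z)
  let F' : CN N →L[ℝ] (Fin κ → ℝ) × ℂ :=
    (ContinuousLinearMap.pi fun i => fderiv ℝ (r i) q).prod
      ((fderiv ℂ k q).restrictScalars ℝ)
  have hF : HasStrictFDerivAt F F' q :=
    (hasStrictFDerivAt_pi.2 fun i => (hr i).hasStrictFDerivAt).prodMk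
      (hk.hasStrictFDerivAt.restrictScalars ℝ)
  have hsurj : F'.range = ⊤ := by
    have h1 : LinearIndependent ℝ fun i => (fderiv ℝ (r i) q).toLinearMap :=
      hind.map' (ContinuousLinearMap.coeLM ℝ) (LinearMap.ker_eq_bot.2
        ContinuousLinearMap.coe_injective)
    refine LinearMap.range_eq_top.2 ?_
    rintro ⟨y, c⟩
    obtain ⟨w, hw⟩ := h1.surjective_pi_dual y
    have hw' : ∀ i, fderiv ℝ (r i) q w = y i := fun i => congrFun hw i
    set m : ℂ := (c - fderiv ℂ k q w) / fderiv ℂ k q v with hm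
    refine ⟨w + (m.re • v + m.im • (I • v)), ?_⟩
    refine Prod.ext (funext fun i => ?_) ?_
    · change fderiv ℝ (r i) q _ = y i
      simp only [map_add, map_smul, hv1, hv2, hw', smul_zero, add_zero]
    · change fderiv ℂ k q _ = c
      have h2 : m.re • v + m.im • (I • v) = m • v := by
        conv_rhs => rw [← re_add_im m, add_smul, mul_smul]
        simp
      rw [h2, map_add, map_smul, smul_eq_mul, hm, div_mul_cancel₀ _ hkv]
      ring
  have hmap := hF.map_nhds_eq_of_surj hsurj
  have himg : F '' (W ∩ V) ∈ 𝓝 (F q) := by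
    rw [← hmap]
    exact image_mem_map (inter_mem hW (hV.mem_nhds hq.2))
  have hFq : F q = (0, k q) := by
    rw [hX] at hq
    exact Prod.ext (funext hq.2) rfl
  have hc : Tendsto (fun c : ℂ => ((0 : Fin κ → ℝ), c)) (𝓝 (k q)) (𝓝 (F q)) := by
    rw [hFq]
    exact (continuous_const.prodMk continuous_id).tendsto _
  filter_upwards [hc himg] with c ⟨z, ⟨hzW, hzV⟩, hz⟩
  have hzM : z ∈ M ∩ V := by
    rw [hX]
    exact ⟨hzV, fun i => congrFun (congrArg Prod.fst hz) i⟩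
  exact ⟨z, ⟨hzM.1, hzW⟩, congrArg Prod.snd hz⟩

/-- A generic submanifold carrying a nonconstant CR function of rank one is not minimal: level
sets of its real part are CR submanifolds of the same CR dimension. -/
theorem not_isMinimalAt_of_crTangent (hV : IsOpen V)
    (hX : M ∩ V = {z ∈ V | ∀ i, r i z = 0})
    (hr : ∀ i, AnalyticOnNhd ℝ (r i) V)
    (hind : ∀ z ∈ V, LinearIndependent ℝ fun i => fderiv ℝ (r i) z)
    (hgen : ∀ z ∈ V, LinearIndependent ℂ fun i => delForm N (r i) z)
    (hq : q ∈ M ∩ V) (hk : AnalyticAt ℂ k q)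
    (hrank : ∀ᶠ z in 𝓝[M] q, ∀ v ∈ crTangent N M z, fderiv ℂ k z v = 0)
    {v : CN N} (hv : v ∈ tangentConeAt ℝ M q) (hkv : fderiv ℂ k q v ≠ 0) :
    ¬ IsMinimalAt N M q := by
  have hT : ∀ z ∈ M ∩ V, tangentConeAt ℝ M z = {v | ∀ i, fderiv ℝ (r i) z v = 0} := fun z hz =>
    tangentConeAt_eq_ker hV hX hz (fun i => hr i z hz.2) (hind z hz.2)
  let Λ : ℂ →L[ℝ] ℝ := reCLM ∘L
    ((ContinuousLinearMap.mul ℂ ℂ (starRingEnd ℂ (fderiv ℂ k q v))).restrictScalars ℝ)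
  let φ : CN N → ℝ := fun z => Λ (k z - k q)
  have hφd : ∀ z, AnalyticAt ℂ k z → ∀ u, fderiv ℝ φ z u = Λ (fderiv ℂ k z u) := by
    intro z hz u
    have h1 : HasFDerivAt (fun z => k z - k q) ((fderiv ℂ k z).restrictScalars ℝ) z :=
      (hz.differentiableAt.hasFDerivAt.sub_const _).restrictScalars ℝ
    have h2 : HasFDerivAt φ (Λ ∘L (fderiv ℂ k z).restrictScalars ℝ) z :=
      Λ.hasFDerivAt.comp z h1
    rw [h2.fderiv]
    rfl
  have hφa : ∀ z, AnalyticAt ℂ k z → AnalyticAt ℝ φ z := fun z hz =>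
    (Λ.analyticAt _).comp ((hz.restrictScalars (𝕜 := ℝ)).sub analyticAt_const)
  have hφv : fderiv ℝ φ q v ≠ 0 := by
    rw [hφd q hk]
    have : Λ (fderiv ℂ k q v) = normSq (fderiv ℂ k q v) := by
      simp [Λ, normSq_apply]
    rw [this]
    exact (normSq_pos.2 hkv).ne'
  let r' : Fin (κ + 1) → CN N → ℝ := Fin.cons φ r
  have hr'0 : r' 0 = φ := rfl
  have hr's : ∀ i : Fin κ, r' i.succ = r i := fun i => rfl
  have hr'a : ∀ z ∈ V, AnalyticAt ℂ k z → ∀ i, AnalyticAt ℝ (r' i) z := by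
    intro z hz hkz i
    refine Fin.cases (hφa z hkz) (fun i => hr i z hz) i
  have hind' : LinearIndependent ℝ fun i => fderiv ℝ (r' i) q := by
    have heq : (fun i => fderiv ℝ (r' i) q) =
        Fin.cons (fderiv ℝ φ q) (fun i => fderiv ℝ (r i) q) := by
      funext i
      refine Fin.cases rfl (fun i => rfl) i
    rw [heq, linearIndependent_finCons]
    refine ⟨hind q hq.2, fun hmem => hφv ?_⟩
    have hle : Submodule.span ℝ (range fun i => fderiv ℝ (r i) q) ≤
        LinearMap.ker (ContinuousLinearMap.apply ℝ ℝ v).toLinearMap := by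
      refine Submodule.span_le.2 ?_
      rintro _ ⟨i, rfl⟩
      rw [hT q hq] at hv
      exact hv i
    exact hle hmem
  have hev : ∀ᶠ z in 𝓝 q, LinearIndependent ℝ fun i => fderiv ℝ (r' i) z := by
    have hc : ContinuousAt (fun z i => fderiv ℝ (r' i) z) q :=
      continuousAt_pi.2 fun i => (hr'a q hq.2 hk i).fderiv.continuousAt
    exact hc.eventually (isOpen_setOfPred_linearIndependent.mem_nhds hind')
  obtain ⟨V', hV', hV'o, hqV'⟩ := eventually_nhds_iff.1
    ((hev.and hk.eventually_analyticAt).and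
      ((eventually_nhdsWithin_iff.1 hrank).and (hV.mem_nhds hq.2)))
  have hφq : φ q = 0 := by simp [φ]
  let M' : Set (CN N) := {z | z ∈ M ∩ V' ∧ φ z = 0}
  have hM'V' : M' ∩ V' = {z ∈ V' | ∀ i, r' i z = 0} := by
    ext z
    constructor
    · rintro ⟨⟨⟨hzM, hzV'⟩, hzφ⟩, -⟩
      have : z ∈ M ∩ V := ⟨hzM, (hV' z hzV').2.2⟩
      rw [hX] at this
      exact ⟨hzV', fun i => Fin.cases hzφ this.2 i⟩
    · rintro ⟨hzV', hz⟩
      have : z ∈ M ∩ V := by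
        rw [hX]
        exact ⟨(hV' z hzV').2.2, fun i => hz i.succ⟩
      exact ⟨⟨⟨this.1, hzV'⟩, hz 0⟩, hzV'⟩
  have hT' : ∀ z ∈ M', tangentConeAt ℝ M' z = {v | ∀ i, fderiv ℝ (r' i) z v = 0} := fun z hz =>
    tangentConeAt_eq_ker hV'o hM'V' ⟨hz, hz.1.2⟩
      (hr'a z (hV' z hz.1.2).2.2 (hV' z hz.1.2).1.2) (hV' z hz.1.2).1.1
  have hM'M : M' ⊆ M := fun z hz => hz.1.1
  have hdim : κ + 1 ≤ 2 * N := by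
    have h1 := hind'.map' (ContinuousLinearMap.coeLM ℝ) (LinearMap.ker_eq_bot.2
        ContinuousLinearMap.coe_injective)
    have h2 := h1.fintype_card_le_finrank
    have h3 : Module.finrank ℝ (CN N →ₗ[ℝ] ℝ) = 2 * N := by
      rw [Module.finrank_linearMap, Module.finrank_pi_fintype]
      simp [Complex.finrank_real_complex, mul_comm]
    rw [h3] at h2
    simpa using h2
  intro hmin
  obtain ⟨V'', hV''o, hqV'', hsub⟩ := hmin M' ⟨⟨hq.1, hqV'⟩, hφq⟩ hM'M
    (by
      obtain ⟨d, hd⟩ : ∃ d, 2 * N - d = κ + 1 := ⟨2 * N - (κ + 1), by omega⟩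
      refine ⟨d, fun z hz => ?_⟩
      rw [IsSubmanifoldAtDim, hd]
      exact ⟨V', r', hV'o, hz.1.2, fun i y hy =>
        (hr'a y (hV' y hy).2.2 (hV' y hy).1.2 i).analyticWithinAt,
        fun y hy => (hV' y hy).1.1, hM'V'⟩)
    (by
      intro z hz
      have hzV : z ∈ M ∩ V := ⟨hz.1.1, (hV' z hz.1.2).2.2⟩
      have hcr : crTangent N M' z = crTangent N M z := by
        ext u
        refine ⟨fun hu => ⟨tangentConeAt_mono hM'M hu.1, tangentConeAt_mono hM'M hu.2⟩,
          fun hu => ?_⟩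
        have hku := (hV' z hz.1.2).2.1 hz.1.1 u hu
        have hφz := hφd z (hV' z hz.1.2).1.2
        rw [crTangent, hT z hzV] at hu
        rw [crTangent, hT' z hz]
        refine ⟨fun i => Fin.cases ?_ hu.1 i, fun i => Fin.cases ?_ hu.2 i⟩
        · exact (hφz u).trans (by rw [hku, map_zero])
        · exact (hφz (I • u)).trans (by rw [map_smul, hku, smul_zero, map_zero])
      rw [crDim, hcr, ← crDim, crDim_eq (hT z hzV) (hgen z hzV.2),
        crDim_eq (hT q hq) (hgen q hq.2)])
  have hv' : v ∈ tangentConeAt ℝ M' q := by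
    rw [← tangentConeAt_inter_nhds (hV''o.mem_nhds hqV'')] at hv
    exact tangentConeAt_mono hsub hv
  rw [hT' q ⟨⟨hq.1, hqV'⟩, hφq⟩] at hv'
  exact hφv (hv' 0)

end

section

variable {N : ℕ} {M : Set (CN N)}

theorem IsGenericSubmanifoldAt.span_tangentConeAt_eq_top {p : CN N}
    (h : IsGenericSubmanifoldAt N M p) (hp : p ∈ M) :
    Submodule.span ℂ (tangentConeAt ℝ M p) = ⊤ := by
  obtain ⟨V, k, r, hV, hpV, hr, hind, hgen, hX⟩ := h
  rw [tangentConeAt_eq_ker hV hX ⟨hp, hpV⟩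
    (fun i => (hV.analyticOn_iff_analyticOnNhd.1 (hr i)) p hpV) (hind p hpV)]
  exact span_ker_eq_top (hgen p hpV)

/-- Generic submanifolds are uniqueness sets for holomorphic functions. -/
theorem AnalyticOnNhd.eqOn_zero_of_generic (hM : ∀ p ∈ M, IsGenericSubmanifoldAt N M p)
    {B : Set (CN N)} (hB : IsPreconnected B) {h : CN N → ℂ} (hh : AnalyticOnNhd ℂ h B)
    {O : Set (CN N)} (hO : IsOpen O) (hOB : O ⊆ B) {q : CN N} (hq : q ∈ M ∩ O)
    (h0 : ∀ z ∈ M ∩ O, h z = 0) : EqOn h 0 B :=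
  hh.eqOn_zero_of_preconnected_of_eventuallyEq_zero hB (hOB hq.2)
    (AnalyticOnNhd.eventuallyEq_zero_of_span_tangentConeAt (hh.mono hOB) hO
      (fun a ha => (hM a ha.1).span_tangentConeAt_eq_top ha.1) h0 hq)

/-- A holomorphic function whose differential vanishes on the tangent spaces of a generic
submanifold is locally constant. -/
theorem AnalyticOnNhd.eventually_eq_of_fderiv_tangentConeAt
    (hM : ∀ p ∈ M, IsGenericSubmanifoldAt N M p) {O : Set (CN N)} (hO : IsOpen O) {k : CN N → ℂ}
    (hk : AnalyticOnNhd ℂ k O) {q : CN N} (hq : q ∈ M ∩ O)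
    (h0 : ∀ z ∈ M ∩ O, ∀ v ∈ tangentConeAt ℝ M z, fderiv ℂ k z v = 0) :
    ∀ᶠ z in 𝓝 q, k z = k q := by
  have hspan : ∀ z ∈ M ∩ O, Submodule.span ℂ (tangentConeAt ℝ M z) = ⊤ := fun a ha =>
    (hM a ha.1).span_tangentConeAt_eq_top ha.1
  have h1 : fderiv ℂ k =ᶠ[𝓝 q] 0 := by
    refine AnalyticOnNhd.eventuallyEq_zero_of_span_tangentConeAt hk.fderiv hO hspan ?_ hq
    intro z hz
    have hle : Submodule.span ℂ (tangentConeAt ℝ M z) ≤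
        LinearMap.ker (fderiv ℂ k z).toLinearMap := Submodule.span_le.2 fun v hv => h0 z hz v hv
    rw [hspan z hz] at hle
    exact ContinuousLinearMap.ext fun v => hle (Submodule.mem_top (x := v))
  obtain ⟨δ, hδ, hδ'⟩ := Metric.eventually_nhds_iff_ball.1 (h1.and (hO.mem_nhds hq.2))
  filter_upwards [Metric.ball_mem_nhds q hδ] with z hz
  refine Metric.isOpen_ball.is_const_of_fderiv_eq_zero (𝕜 := ℂ) (convex_ball q δ).isPreconnected
    ?_ (fun y hy => (hδ' y hy).1) hz (Metric.mem_ball_self hδ)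
  exact fun y hy => (hk y (hδ' y hy).2).differentiableAt.differentiableWithinAt

theorem IsLeviFlatHypervariety.interior_eq_empty {U H : Set (CN N)}
    (hH : IsLeviFlatHypervariety N U H) (hN : N ≠ 0) : interior H = ∅ := by
  by_contra hne
  have h1 := Real.dimH_of_nonempty_interior (nonempty_iff_ne_empty.2 hne)
  rw [hH.2.2.1] at h1
  have h2 : Module.finrank ℝ (CN N) = 2 * N := by
    rw [Module.finrank_pi_fintype]
    simp [Complex.finrank_real_complex, mul_comm]
  rw [h2] at h1
  have : 2 * N - 1 = 2 * N := by exact_mod_cast h1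
  omega

/-- Choice of the transverse direction `e` along which the Segre varieties are followed. -/
theorem exists_transverse_direction {p0 p zs : CN N} {ε : ℝ} {R : CN N × CN N → ℂ}
    (hR : AnalyticOnNhd ℂ R (Metric.ball p0 ε ×ˢ Metric.ball (star p0) ε))
    (hp : p ∈ Metric.ball p0 ε) (hzs : zs ∈ Metric.ball p0 ε) (hne : R (zs, star p) ≠ 0) :
    ∃ e : CN N, ∃ r > 0, ∃ δ > 0, ∀ z ∈ Metric.ball p δ, ∀ q ∈ Metric.ball p δ,
      q ∈ Metric.ball p0 ε ∧
      (∀ x ∈ Metric.closedBall (0 : ℂ) r, z + x • e ∈ Metric.ball p0 ε ∧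
        R (zs, star (z + x • e)) ≠ 0) ∧
      ∀ x ∈ Metric.sphere (0 : ℂ) r, R (z + x • e, star q) ≠ 0 := by
  let e : CN N := zs - p
  let B := Metric.ball p0 ε
  have hBo : IsOpen B := Metric.isOpen_ball
  have hps := star_mem_ball hp
  let X : Set ℂ := {x | p + x • e ∈ B}
  have hX : Convex ℝ X := by
    intro x hx y hy a b ha hb hab
    have h1 : p + (a • x + b • y) • e = a • (p + x • e) + b • (p + y • e) := by
      have hab' : (a : ℂ) + b = 1 := by exact_mod_cast hab
      ext i
      simp only [Pi.add_apply, Pi.smul_apply, smul_eq_mul, real_smul]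
      linear_combination (-p i) * hab'
    change p + (a • x + b • y) • e ∈ B
    rw [h1]
    exact convex_ball p0 ε hx hy ha hb hab
  have hline : ∀ x, AnalyticAt ℂ (fun x : ℂ => p + x • e) x := fun x =>
    analyticAt_const.add (analyticAt_id.smul analyticAt_const)
  let η : ℂ → ℂ := fun x => R (p + x • e, star p)
  have hη : AnalyticOnNhd ℂ η X := fun x hx =>
    AnalyticAt.comp_of_eq (hR (p + x • e, star p) ⟨hx, hps⟩) ((hline x).prod analyticAt_const) rfl
  have h0X : (0 : ℂ) ∈ X := by
    change p + (0 : ℂ) • e ∈ B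
    rwa [zero_smul, add_zero]
  have h1X : (1 : ℂ) ∈ X := by
    change p + (1 : ℂ) • e ∈ B
    rwa [one_smul, add_sub_cancel]
  have hη0 : ∀ᶠ x in 𝓝[≠] (0 : ℂ), η x ≠ 0 := by
    refine (hη 0 h0X).eventually_eq_zero_or_eventually_ne_zero.resolve_left fun h => hne ?_
    have := hη.eqOn_zero_of_preconnected_of_eventuallyEq_zero hX.isPreconnected h0X h h1X
    simpa [η, e] using this
  have hshift : ∀ z : CN N, ∀ x : ℂ, Tendsto (fun u : (CN N × CN N) × ℂ => u.1.1 + u.2 • e)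
      (𝓝 ((z, z), x)) (𝓝 (z + x • e)) := fun z x =>
    Continuous.tendsto (by fun_prop : Continuous fun u : (CN N × CN N) × ℂ =>
      u.1.1 + u.2 • e) ((z, z), x)
  have hB0 : ∀ᶠ x in 𝓝 (0 : ℂ), p + x • e ∈ B :=
    (hline 0).continuousAt.eventually (hBo.mem_nhds h0X)
  have hs0 : ∀ᶠ x in 𝓝 (0 : ℂ), R (zs, star (p + x • e)) ≠ 0 := by
    have hc : ContinuousAt (fun x : ℂ => R (zs, star (p + x • e))) 0 := by
      refine ContinuousAt.comp_of_eq (y := (zs, star p)) (hR (zs, star p) ⟨hzs, hps⟩).continuousAt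
        (continuousAt_const.prodMk (hline 0).continuousAt.star) (by simp)
    exact hc.eventually_ne (by simpa using hne)
  obtain ⟨r0, hr0, hr0'⟩ := Metric.eventually_nhds_iff_ball.1
    ((hB0.and hs0).and (eventually_nhdsWithin_iff.1 hη0))
  have hr : 0 < r0 / 2 := by positivity
  have hcb : ∀ x ∈ Metric.closedBall (0 : ℂ) (r0 / 2), x ∈ Metric.ball (0 : ℂ) r0 := fun x hx =>
    Metric.closedBall_subset_ball (by linarith) hx
  have hE1 : ∀ᶠ u in 𝓝 (p, p), ∀ x ∈ Metric.closedBall (0 : ℂ) (r0 / 2),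
      u.1 + x • e ∈ B ∧ R (zs, star (u.1 + x • e)) ≠ 0 := by
    refine (isCompact_closedBall (0 : ℂ) (r0 / 2)).eventually_forall_of_forall_eventually
      (P := fun (u : CN N × CN N) x => u.1 + x • e ∈ B ∧ R (zs, star (u.1 + x • e)) ≠ 0) ?_
    intro x hx
    obtain ⟨⟨h1, h2⟩, -⟩ := hr0' x (hcb x hx)
    refine ((hshift p x).eventually (hBo.mem_nhds h1)).and ?_
    have hc : Tendsto (fun u : (CN N × CN N) × ℂ => R (zs, star (u.1.1 + u.2 • e)))
        (𝓝 ((p, p), x)) (𝓝 (R (zs, star (p + x • e)))) :=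
      (hR (zs, star (p + x • e)) ⟨hzs, star_mem_ball h1⟩).continuousAt.tendsto.comp
        (tendsto_const_nhds.prodMk_nhds (hshift p x).star)
    exact hc.eventually_ne h2
  have hE2 : ∀ᶠ u in 𝓝 (p, p), ∀ x ∈ Metric.sphere (0 : ℂ) (r0 / 2),
      R (u.1 + x • e, star u.2) ≠ 0 := by
    refine (isCompact_sphere (0 : ℂ) (r0 / 2)).eventually_forall_of_forall_eventually
      (P := fun (u : CN N × CN N) x => R (u.1 + x • e, star u.2) ≠ 0) ?_
    intro x hx
    obtain ⟨⟨h1, -⟩, h2⟩ := hr0' x (hcb x (Metric.sphere_subset_closedBall hx))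
    have hx0 : x ≠ 0 := by
      rintro rfl
      simp only [mem_sphere_iff_norm, sub_zero, norm_zero] at hx
      linarith
    have hc2 : Tendsto (fun u : (CN N × CN N) × ℂ => star u.1.2) (𝓝 ((p, p), x)) (𝓝 (star p)) :=
      Continuous.tendsto (by fun_prop : Continuous fun u : (CN N × CN N) × ℂ => star u.1.2)
        ((p, p), x)
    have hc : Tendsto (fun u : (CN N × CN N) × ℂ => R (u.1.1 + u.2 • e, star u.1.2))
        (𝓝 ((p, p), x)) (𝓝 (R (p + x • e, star p))) :=
      (hR (p + x • e, star p) ⟨h1, hps⟩).continuousAt.tendsto.comp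
        ((hshift p x).prodMk_nhds hc2)
    exact hc.eventually_ne (h2 hx0)
  have hE3 : ∀ᶠ u in 𝓝 (p, p), (u : CN N × CN N).2 ∈ B :=
    continuous_snd.continuousAt.eventually (hBo.mem_nhds hp)
  obtain ⟨δ, hδ, hδ'⟩ := Metric.eventually_nhds_iff_ball.1 (hE1.and (hE2.and hE3))
  refine ⟨e, r0 / 2, hr, δ, hδ, fun z hz q hq => ?_⟩
  have h := hδ' (z, q) (by rw [← ball_prod_same]; exact ⟨hz, hq⟩)
  exact ⟨h.2.2, h.1, h.2.1⟩

end

section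

variable {N : ℕ} {H M : Set (CN N)} {p0 b e : CN N} {ε r : ℝ} {R : CN N × CN N → ℂ}

/-- Near a Levi-flat hypersurface point `q`, the Segre variety of `q` meets the line through `b`
in a point of `H`. -/
theorem IsLeviFlatHypAt.exists_mem_segre_line {q : CN N} {δ : ℝ} (hLF : IsLeviFlatHypAt N H q)
    (hr : 0 < r) (hR : AnalyticOnNhd ℂ R (Metric.ball p0 ε ×ˢ Metric.ball (star p0) ε))
    (hsym : ∀ z w, R (star w, star z) = star (R (z, w)))
    (hHR : ∀ z ∈ Metric.ball p0 ε, z ∈ H ↔ R (z, star z) = 0) (hqH : q ∈ H) {p : CN N}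
    (hline : ∀ z ∈ Metric.ball p (5 * δ), ∀ q ∈ Metric.ball p (5 * δ),
      q ∈ Metric.ball p0 ε ∧ (∀ x ∈ Metric.closedBall (0 : ℂ) r, z + x • e ∈ Metric.ball p0 ε) ∧
      ∀ x ∈ Metric.sphere (0 : ℂ) r, R (z + x • e, star q) ≠ 0)
    (hq : q ∈ Metric.ball p δ) (hb : b ∈ Metric.ball p δ) :
    ∃ x ∈ Metric.ball (0 : ℂ) r, R (b + x • e, star q) = 0 ∧
      R (b + x • e, star (b + x • e)) = 0 := by
  obtain ⟨V, f, hVo, hqV, hf, hdf, hHV⟩ := hLF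
  have hδ : 0 < δ := Metric.pos_of_mem_ball hq
  have hqδ : q ∈ Metric.ball p (5 * δ) := Metric.ball_subset_ball (by linarith) hq
  have hqB := (hline q hqδ q hqδ).1
  have hseg : ∀ t ∈ Metric.ball (0 : ℂ) 2, q + t • (b - q) ∈ Metric.ball p (5 * δ) := by
    intro t ht
    rw [mem_ball_iff_norm] at *
    rw [sub_zero] at ht
    have h1 : ‖b - q‖ ≤ 2 * δ := by
      have : b - q = (b - p) - (q - p) := by abel
      rw [this]
      exact (norm_sub_le _ _).trans (by linarith)
    have h2 : ‖t • (b - q)‖ ≤ 4 * δ := by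
      rw [norm_smul]
      nlinarith [norm_nonneg t, norm_nonneg (b - q)]
    have h3 : q + t • (b - q) - p = (q - p) + t • (b - q) := by abel
    rw [h3]
    exact (norm_add_le _ _).trans_lt (by linarith)
  refine _root_.exists_mem_segre_line hr hR hsym hqB
    (hVo.analyticOn_iff_analyticOnNhd.1 hf q hqV) (hdf q hqV) ?_
    (fun t ht => (hline _ (hseg t ht) q hqδ).2.1) (fun t ht => (hline _ (hseg t ht) q hqδ).2.2)
  filter_upwards [hVo.mem_nhds hqV, Metric.isOpen_ball.mem_nhds hqB] with z hzV hzB hfz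
  have h1 : q ∈ H ∩ V := ⟨hqH, hqV⟩
  rw [hHV] at h1
  have h2 : z ∈ H ∩ V := by
    rw [hHV]
    exact ⟨hzV, by rw [hfz]; exact h1.2⟩
  exact (hHR z hzB).1 h2.1

/-- Parameters on the line through `b`, conjugated, of the points of `H`. -/
def lineZeros (R : CN N × CN N → ℂ) (b e : CN N) (r : ℝ) : Set ℂ :=
  Metric.closedBall 0 r ∩
    (fun x : ℂ => R (b + star x • e, star b + x • star e)) ⁻¹' {0}

theorem star_add_star_smul (b e : CN N) (x : ℂ) :
    star (b + star x • e) = star b + x • star e := by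
  rw [star_add, star_smul, star_star]

theorem analyticOnNhd_lineZeros
    (hR : AnalyticOnNhd ℂ R (Metric.ball p0 ε ×ˢ Metric.ball (star p0) ε))
    (hline : ∀ x ∈ Metric.closedBall (0 : ℂ) r, b + x • e ∈ Metric.ball p0 ε) :
    AnalyticOnNhd ℝ (fun x : ℂ => R (b + star x • e, star b + x • star e))
      (Metric.closedBall 0 r) := by
  intro x hx
  have hx' : star x ∈ Metric.closedBall (0 : ℂ) r := by simpa using hx
  have hmem := hline _ hx'
  have h1 : AnalyticAt ℝ R (b + star x • e, star b + x • star e) :=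
    (hR (b + star x • e, star b + x • star e)
      ⟨hmem, by rw [← star_add_star_smul]; exact star_mem_ball hmem⟩).restrictScalars
  have hst : AnalyticAt ℝ (fun x : ℂ => star x) x := conjCLE.toContinuousLinearMap.analyticAt x
  have hl1 : AnalyticAt ℝ (fun x : ℂ => b + star x • e) x :=
    analyticAt_const.add (hst.smul analyticAt_const)
  have hl2 : AnalyticAt ℝ (fun x : ℂ => star b + x • star e) x :=
    analyticAt_const.add (analyticAt_id.smul analyticAt_const)
  exact AnalyticAt.comp_of_eq (g := R) h1 (hl1.prod hl2) rfl

theorem isCompact_lineZeros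
    (hR : AnalyticOnNhd ℂ R (Metric.ball p0 ε ×ˢ Metric.ball (star p0) ε))
    (hline : ∀ x ∈ Metric.closedBall (0 : ℂ) r, b + x • e ∈ Metric.ball p0 ε) :
    IsCompact (lineZeros R b e r) :=
  (isCompact_closedBall (0 : ℂ) r).of_isClosed_subset
    ((analyticOnNhd_lineZeros hR hline).continuousOn.preimage_isClosed_of_isClosed
      Metric.isClosed_closedBall isClosed_singleton) inter_subset_left

theorem exists_not_isMinimalAt (hint : interior H = ∅) (hp0 : p0 ∈ M) (hε : 0 < ε)
    (hLF : ∀ q ∈ hypStar N H, IsLeviFlatHypAt N H q)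
    (hMsub : M ⊆ closure (hypStar N H))
    (hMgen : ∀ p ∈ M, IsGenericSubmanifoldAt N M p)
    (hR : AnalyticOnNhd ℂ R (Metric.ball p0 ε ×ˢ Metric.ball (star p0) ε))
    (hsym : ∀ z w, R (star w, star z) = star (R (z, w)))
    (hHR : ∀ z ∈ Metric.ball p0 ε, z ∈ H ↔ R (z, star z) = 0) :
    ∃ q ∈ M, ¬ IsMinimalAt N M q := by
  have hBc : IsPreconnected (Metric.ball p0 ε) := (convex_ball p0 ε).isPreconnected
  have hsym0 : ∀ z w, R (z, star w) = 0 → R (w, star z) = 0 := by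
    intro z w h
    have := hsym z (star w)
    rw [h, star_zero, star_star] at this
    exact this
  have hslice : ∀ w ∈ Metric.ball p0 ε,
      AnalyticOnNhd ℂ (fun z => R (z, star w)) (Metric.ball p0 ε) := fun w hw z hz =>
    analyticAt_star_snd (hR _ ⟨hz, star_mem_ball hw⟩)
  obtain ⟨p, hp, zs, hzs, hne⟩ : ∃ p ∈ M ∩ Metric.ball p0 ε, ∃ zs ∈ Metric.ball p0 ε,
      R (zs, star p) ≠ 0 := by
    by_contra! hall
    have hsub : Metric.ball p0 ε ⊆ H := by
      intro z hz
      rw [hHR z hz]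
      exact (hslice z hz).eqOn_zero_of_generic hMgen hBc Metric.isOpen_ball subset_rfl
        ⟨hp0, Metric.mem_ball_self hε⟩ (fun w hw => hsym0 _ _ (hall w hw z hz)) hz
    have := interior_maximal hsub Metric.isOpen_ball (Metric.mem_ball_self hε)
    rw [hint] at this
    exact this
  obtain ⟨e, r, hr, δ', hδ', hline⟩ := exists_transverse_direction hR hp.2 hzs hne
  obtain ⟨δ, rfl⟩ : ∃ δ, δ' = 5 * δ := ⟨δ' / 5, by ring⟩
  have hδ : 0 < δ := by linarith
  have hδ5 : Metric.ball p δ ⊆ Metric.ball p (5 * δ) := Metric.ball_subset_ball (by linarith)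
  have hpδ : p ∈ Metric.ball p δ := Metric.mem_ball_self hδ
  obtain ⟨b, hb, hbH⟩ : ∃ b ∈ Metric.ball p δ, b ∉ H := by
    by_contra! hall
    have := interior_maximal hall Metric.isOpen_ball hpδ
    rw [hint] at this
    exact this
  have hb5 := hδ5 hb
  have hbl : ∀ x ∈ Metric.closedBall (0 : ℂ) r, b + x • e ∈ Metric.ball p0 ε := fun x hx =>
    ((hline b hb5 b hb5).2.1 x hx).1
  let K := lineZeros R b e r
  have hK : IsCompact K := isCompact_lineZeros hR hbl
  have hstar : ∀ x ∈ Metric.closedBall (0 : ℂ) r, star x ∈ Metric.closedBall (0 : ℂ) r :=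
    fun x hx => by simpa using hx
  let G : CN N × ℂ → ℂ := fun u => R (u.1, star b + u.2 • star e)
  have hGa : ∀ q ∈ Metric.ball p δ, ∀ x ∈ Metric.closedBall (0 : ℂ) r, AnalyticAt ℂ G (q, x) := by
    intro q hq x hx
    have h1 := star_mem_ball (hbl _ (hstar x hx))
    rw [star_add_star_smul] at h1
    exact AnalyticAt.comp_of_eq (hR (q, star b + x • star e) ⟨(hline b hb5 q (hδ5 hq)).1, h1⟩)
      (analyticAt_fst.prod (analyticAt_const.add (analyticAt_snd.smul analyticAt_const))) rfl
  have hGstar : ∀ q x, G (q, x) = R (q, star (b + star x • e)) := fun q x => by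
    rw [star_add_star_smul]
  have hG0 : ∀ q ∈ M ∩ Metric.ball p δ, ∃ x ∈ K, G (q, x) = 0 := by
    intro q hq
    by_contra! hno
    have hev : ∀ᶠ z in 𝓝 q, ∀ x ∈ K, G (z, x) ≠ 0 :=
      hK.eventually_forall_of_forall_eventually (P := fun z x => G (z, x) ≠ 0) fun x hx =>
        (hGa q hq.2 x hx.1).continuousAt.eventually_ne (hno x hx)
    obtain ⟨z, ⟨hz, hzδ⟩, hzs⟩ := mem_closure_iff_nhds.1 (hMsub hq.1) _
      (inter_mem hev (Metric.isOpen_ball.mem_nhds hq.2))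
    obtain ⟨x, hx, hx1, hx2⟩ := (hLF z hzs).exists_mem_segre_line (e := e) hr hR hsym hHR hzs.1
      (fun z hz q hq => ⟨(hline z hz q hq).1, fun x hx => ((hline z hz q hq).2.1 x hx).1,
        (hline z hz q hq).2.2⟩) hzδ hb
    refine hz (star x) ⟨hstar x (Metric.ball_subset_closedBall hx), ?_⟩ ?_
    · change R (b + star (star x) • e, star b + star x • star e) = 0
      rw [← star_add_star_smul, star_star]
      exact hx2
    · rw [hGstar, star_star]
      exact hsym0 _ _ hx1
  have hGp : ∀ x ∈ K, ¬ ∀ᶠ y in 𝓝 x, G (p, y) = 0 := by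
    intro x hx h0
    have ha : AnalyticOnNhd ℂ (fun y => G (p, y)) (Metric.closedBall 0 r) := fun y hy =>
      AnalyticAt.comp_of_eq (g := G) (hGa p hpδ y hy) (analyticAt_const.prod analyticAt_id) rfl
    have hz := ha.eqOn_zero_of_preconnected_of_eventuallyEq_zero
      (convex_closedBall _ _).isPreconnected hx.1 h0
    have hrs : (r : ℂ) ∈ Metric.sphere (0 : ℂ) r := by simp [abs_of_pos hr]
    have h1 : G (p, (r : ℂ)) = 0 := hz (Metric.sphere_subset_closedBall hrs)
    rw [hGstar] at h1
    have h2 := hsym0 _ _ h1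
    rw [RCLike.star_def, conj_ofReal] at h2
    exact (hline b hb5 p (hδ5 hpδ)).2.2 r hrs h2
  obtain ⟨q1, hq1, k, hk, hsel⟩ := exists_analyticAt_selection hK
    (fun q hq x hx => hGa q hq.2 x hx.1) hG0 ⟨hp.1, hpδ⟩ hGp
  rw [nhdsWithin_inter_of_mem' (mem_nhdsWithin_of_mem_nhds (Metric.isOpen_ball.mem_nhds hq1.2))]
    at hsel
  obtain ⟨O, hO, hOo, hqO⟩ := eventually_nhds_iff.1 ((eventually_nhdsWithin_iff.1 hsel).and
    (hk.eventually_analyticAt.and (Metric.isOpen_ball.mem_nhds hq1.2)))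
  obtain ⟨q2, hq2, v, hv, hkv⟩ : ∃ q2 ∈ M ∩ O, ∃ v ∈ tangentConeAt ℝ M q2,
      fderiv ℂ k q2 v ≠ 0 := by
    by_contra! hall
    have hconst := AnalyticOnNhd.eventually_eq_of_fderiv_tangentConeAt hMgen hOo
      (fun z hz => (hO z hz).2.1) ⟨hq1.1, hqO⟩ hall
    obtain ⟨W, hW, hWo, hqW⟩ := eventually_nhds_iff.1 (hconst.and (hOo.mem_nhds hqO))
    have hκ := ((hO q1 hqO).1 hq1.1).1
    have hP := hbl _ (hstar _ hκ.1)
    have h0 := (hslice _ hP).eqOn_zero_of_generic hMgen hBc hWo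
      (fun z hz => (hline b hb5 z (hδ5 (hO z (hW z hz).2).2.2)).1) ⟨hq1.1, hqW⟩ (fun z hz => by
        have h1 := ((hO z (hW z hz.2).2).1 hz.1).2
        rw [hGstar, (hW z hz.2).1] at h1
        exact h1)
    exact ((hline b hb5 b hb5).2.1 _ (hstar _ hκ.1)).2 (h0 hzs)
  obtain ⟨V, κ, ρ, hVo, hq2V, hρ, hind, hgen, hX⟩ := hMgen q2 hq2.1
  have hρ' := fun i => hVo.analyticOn_iff_analyticOnNhd.1 (hρ i)
  refine ⟨q2, hq2.1, not_isMinimalAt_of_crTangent hVo hX hρ' hind hgen ⟨hq2.1, hq2V⟩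
    (hO q2 hq2.2).2.1 ?_ hv hkv⟩
  filter_upwards [self_mem_nhdsWithin,
    mem_nhdsWithin_of_mem_nhds ((hOo.inter hVo).mem_nhds ⟨hq2.2, hq2V⟩)] with z hzM hz u hu
  by_contra hku
  have hKn : K ∈ 𝓝 (k z) := by
    refine mem_of_superset (image_mem_nhds_of_crTangent hVo hX ⟨hzM, hz.2⟩
      (fun i => hρ' i z hz.2) (hind z hz.2) (hO z hz.1).2.1 hu hku (hOo.mem_nhds hz.1)) ?_
    rintro _ ⟨w, hw, rfl⟩
    exact ((hO w hw.2).1 hw.1).1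
  have h0 := (analyticOnNhd_lineZeros hR hbl).eqOn_zero_of_preconnected_of_eventuallyEq_zero
    (convex_closedBall _ _).isPreconnected (mem_of_mem_nhds hKn).1
    (mem_of_superset hKn fun x hx => hx.2)
  have h1 := h0 (Metric.mem_closedBall_self hr.le)
  simp only [star_zero, zero_smul, add_zero, Pi.zero_apply] at h1
  exact hbH ((hHR b (hline b hb5 b hb5).1).2 h1)

end

/-- a (nonempty) real-analytic generic submanifold contained in
`closure H* ∩ U` for a Levi-flat real-hypervariety `H` is not a minimal CR
submanifold (i.e., it is not minimal at every point). -/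
theorem stmt14 (N : ℕ) (U H : Set (CN N)) (hH : IsLeviFlatHypervariety N U H)
    (M : Set (CN N)) (hMne : M.Nonempty)
    (hMsub : M ⊆ closure (hypStar N H) ∩ U)
    (hMman : ∃ d, ∀ p ∈ M, IsSubmanifoldAtDim N d M p)
    (hMgen : ∀ p ∈ M, IsGenericSubmanifoldAt N M p) :
    ¬∀ p ∈ M, IsMinimalAt N M p := by
  obtain ⟨p0, hp0⟩ := hMne
  have hN : N ≠ 0 := by
    rintro rfl
    obtain ⟨z, hz⟩ := closure_nonempty_iff.1 ⟨p0, (hMsub hp0).1⟩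
    obtain ⟨V, f, -, hzV, -, hdf, -⟩ := hH.2.2.2 z hz
    refine hdf z hzV (ContinuousLinearMap.ext fun v => ?_)
    rw [Subsingleton.elim v 0, map_zero, map_zero]
  obtain ⟨V, hVo, hpV, -, m, f, hf, hHV⟩ := hH.2.1.2.2 p0 (hMsub hp0).2
  have hρ : AnalyticAt ℝ (fun z => ∑ i, f i z ^ 2) p0 :=
    Finset.univ.analyticAt_fun_sum fun i _ =>
      (hVo.analyticOn_iff_analyticOnNhd.1 (hf i) p0 hpV).pow 2
  obtain ⟨ε, hε, R, hR, hRρ, hsym⟩ := hρ.exists_complexification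
  obtain ⟨ε', hε', hεV⟩ := Metric.isOpen_iff.1 hVo p0 hpV
  have hle := min_le_left ε ε'
  obtain ⟨q, hq, hmin⟩ := exists_not_isMinimalAt (R := R) (hH.interior_eq_empty hN) hp0
    (lt_min hε hε') hH.2.2.2 (fun z hz => (hMsub hz).1) hMgen
    (hR.mono (prod_mono (Metric.ball_subset_ball hle) (Metric.ball_subset_ball hle))) hsym
    (by
      intro z hz
      have hzV : z ∈ V := hεV (Metric.ball_subset_ball (min_le_right _ _) hz)
      have h1 : z ∈ H ↔ z ∈ H ∩ V := ⟨fun h => ⟨h, hzV⟩, fun h => h.1⟩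
      rw [h1, hHV, hRρ z (Metric.ball_subset_ball hle hz), ofReal_eq_zero,
        Finset.sum_eq_zero_iff_of_nonneg fun i _ => sq_nonneg (f i z)]
      constructor
      · rintro ⟨-, h⟩ i -
        rw [h i, sq, zero_mul]
      · exact fun h => ⟨hzV, fun i => pow_eq_zero_iff (two_ne_zero) |>.1 (h i (Finset.mem_univ i))⟩)
  exact fun h => hmin (h q hq)
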